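/- arXiv:1810.03567 — 5 statements merged into one kernel-verified Lean document; each statement's English description precedes it below -/
import Mathlib

section
/- Let n ≥ 1, 0 < a < 1, and let O ⊆ ℝ^n be open. Then the function φ_a : O → ℝ defined by φ_a(x) = ∫_{ℝ^n \ O} |x − y|^{−(n+2a)} dy is locally Lipschitz on O; that is, for every compact set K ⊆ O there is a constant L_K such that |φ_a(x) − φ_a(x′)| ≤ L_K |x − x′| for all x, x′ ∈ K. -/
open MeasureTheory

theorem abs_rpow_neg_sub_rpow_neg_le {p m s t : ℝ} (hp : 0 ≤ p) (hm : 0 < m) (hs : m ≤ s)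
    (ht : m ≤ t) : |s ^ (-p) - t ^ (-p)| ≤ p * m ^ (-(p + 1)) * |s - t| := by
  have h_deriv : ∀ u ∈ Set.Ici m,
      HasDerivWithinAt (fun u : ℝ => u ^ (-p)) (-p * u ^ (-p - 1)) (Set.Ici m) u := fun u hu =>
    (Real.hasDerivAt_rpow_const (Or.inl (hm.trans_le hu).ne')).hasDerivWithinAt
  refine (convex_Ici m).norm_image_sub_le_of_norm_hasDerivWithin_le h_deriv (fun u hu => ?_) ht hs
  have hu0 : 0 < u := hm.trans_le hu
  rw [norm_mul, norm_neg, Real.norm_of_nonneg hp, Real.norm_of_nonneg (by positivity), neg_add']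
  gcongr p * ?_
  exact Real.rpow_le_rpow_of_nonpos hm hu (by linarith)

theorem IsCompact.exists_pos_mul_one_add_norm_le_norm_sub {E : Type*} [NormedAddCommGroup E]
    {K O : Set E} (hK : IsCompact K) (hO : IsOpen O) (hKO : K ⊆ O) :
    ∃ c : ℝ, 0 < c ∧ ∀ x ∈ K, ∀ y ∈ Oᶜ, c * (1 + ‖y‖) ≤ ‖x - y‖ := by
  obtain ⟨δ, hδ, h_sub⟩ := hK.exists_thickening_subset_open hO hKO
  obtain ⟨R, hR, hKR⟩ := hK.isBounded.exists_pos_norm_le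
  refine ⟨δ / (1 + R + δ), by positivity, fun x hx y hy => ?_⟩
  have h_far : δ ≤ ‖x - y‖ := by
    by_contra! h
    refine hy (h_sub (Metric.mem_thickening_iff.2 ⟨x, hx, ?_⟩))
    rwa [dist_comm, dist_eq_norm]
  have h_norm : ‖y‖ ≤ R + ‖x - y‖ := by
    have := norm_sub_le x (x - y)
    rw [sub_sub_cancel] at this
    linarith [hKR x hx]
  rw [div_mul_eq_mul_div, div_le_iff₀ (by positivity)]
  nlinarith [mul_le_mul_of_nonneg_left h_norm hδ.le]

/-- The killing potential `φ_a(x) = ∫_{ℝⁿ \ O} |x − y|^{−(n+2a)} dy` is locally Lipschitz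
on the open set `O`. -/
theorem stmt4 (n : ℕ) (hn : 1 ≤ n) (a : ℝ) (ha : 0 < a) (ha' : a < 1)
    (O : Set (EuclideanSpace ℝ (Fin n))) (hO : IsOpen O) :
    ∀ K ⊆ O, IsCompact K →
      ∃ L : ℝ, ∀ x ∈ K, ∀ x' ∈ K,
        |(∫ y in Oᶜ, ‖x - y‖ ^ (-((n : ℝ) + 2 * a))) -
            ∫ y in Oᶜ, ‖x' - y‖ ^ (-((n : ℝ) + 2 * a))| ≤ L * ‖x - x'‖ := by
  intro K hKO hK
  obtain ⟨c, hc, hcK⟩ := hK.exists_pos_mul_one_add_norm_le_norm_sub hO hKO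
  set p : ℝ := n + 2 * a
  have hp : 0 < p := by positivity
  have h_tail : ∀ q, p ≤ q → IntegrableOn
      (fun y : EuclideanSpace ℝ (Fin n) => (c * (1 + ‖y‖)) ^ (-q)) Oᶜ := by
    intro q hq
    have h := (integrable_one_add_norm (E := EuclideanSpace ℝ (Fin n)) (μ := volume) (r := q)
      (by rw [finrank_euclideanSpace_fin]; linarith)).const_mul (c ^ (-q))
    refine Integrable.integrableOn (h.congr (ae_of_all _ fun y => ?_))
    exact (Real.mul_rpow hc.le (by positivity)).symm
  have h_int : ∀ x ∈ K, IntegrableOn (fun y => ‖x - y‖ ^ (-p)) Oᶜ := by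
    intro x hx
    refine (h_tail p le_rfl).mono' (Measurable.aestronglyMeasurable (by fun_prop)) ?_
    refine (ae_restrict_iff' hO.measurableSet.compl).2 (ae_of_all _ fun y hy => ?_)
    rw [Real.norm_of_nonneg (by positivity)]
    exact Real.rpow_le_rpow_of_nonpos (by positivity) (hcK x hx y hy) (by linarith)
  refine ⟨∫ y in Oᶜ, p * (c * (1 + ‖y‖)) ^ (-(p + 1)), fun x hx x' hx' => ?_⟩
  rw [← integral_sub (h_int x hx) (h_int x' hx'), ← integral_mul_const, ← Real.norm_eq_abs]
  refine norm_integral_le_of_norm_le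
    (((h_tail (p + 1) (by linarith)).const_mul p).mul_const ‖x - x'‖) ?_
  refine (ae_restrict_iff' hO.measurableSet.compl).2 (ae_of_all _ fun y hy => ?_)
  refine (abs_rpow_neg_sub_rpow_neg_le hp.le (by positivity)
    (hcK x hx y hy) (hcK x' hx' y hy)).trans ?_
  gcongr
  simpa using abs_norm_sub_norm_le (x - y) (x' - y)
end

section
/- Let n ≥ 1, 0 < a < 1, and let O ⊆ ℝ^n be a bounded open set. Assume the fractional Hardy inequality holds on O: there exists C_H > 0 such that for all u ∈ C_c^∞(O), ∫_O u(x)² · dist(x, ℝ^n \ O)^{−2a} dx ≤ C_H ( ∫_O u² dx + ∫_O ∫_O |u(x) − u(y)|² / |x − y|^{n+2a} dy dx ). Then there exists C > 0 such that for all u ∈ C_c^∞(O): ∫_O ( ∫_O (u(x) − u(y)) / |x − y|^{n+a} dy )² dx ≤ C ( ∫_O u² dx + ∫_O ∫_O |u(x) − u(y)|² / |x − y|^{n+2a} dy dx ). -/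
open MeasureTheory Module Set FourierTransform
open scoped ENNReal SchwartzMap InnerProductSpace

section Kernel

variable {E : Type*} [NormedAddCommGroup E] [InnerProductSpace ℝ E] [FiniteDimensional ℝ E]
  [MeasurableSpace E] [BorelSpace E]

/-- The kernel `‖h‖ ^ (-(d + s))` of fractional order `s`, `d` being the dimension of `E`. -/
noncomputable def fracKernel (s : ℝ) (h : E) : ℝ := (‖h‖ ^ ((finrank ℝ E : ℝ) + s))⁻¹

omit [FiniteDimensional ℝ E] [MeasurableSpace E] [BorelSpace E] in
lemma fracKernel_nonneg (s : ℝ) (h : E) : 0 ≤ fracKernel s h := by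
  unfold fracKernel; positivity

omit [FiniteDimensional ℝ E] [MeasurableSpace E] [BorelSpace E] in
lemma fracKernel_neg (s : ℝ) (h : E) : fracKernel s (-h) = fracKernel s h := by
  simp [fracKernel]

omit [FiniteDimensional ℝ E] in
@[fun_prop]
lemma measurable_fracKernel (s : ℝ) : Measurable (fracKernel s : E → ℝ) := by
  unfold fracKernel; fun_prop

omit [FiniteDimensional ℝ E] [MeasurableSpace E] [BorelSpace E] in
lemma enorm_fracKernel (s : ℝ) (h : E) : ‖fracKernel s h‖ₑ = ENNReal.ofReal (fracKernel s h) :=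
  Real.enorm_of_nonneg (fracKernel_nonneg s h)

omit [FiniteDimensional ℝ E] [MeasurableSpace E] [BorelSpace E] in
lemma fracKernel_smul (s : ℝ) {r : ℝ} (hr : 0 < r) (h : E) :
    fracKernel s (r • h) = (r ^ ((finrank ℝ E : ℝ) + s))⁻¹ * fracKernel s h := by
  unfold fracKernel
  rw [norm_smul, Real.norm_of_nonneg hr.le, Real.mul_rpow hr.le (norm_nonneg _), mul_inv]

lemma lintegral_comp_smul_mul_fracKernel (s : ℝ) {r : ℝ} (hr : 0 < r) {F : E → ℝ≥0∞}
    (hF : Measurable F) :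
    ∫⁻ h, F (r • h) * ‖fracKernel s h‖ₑ =
      ENNReal.ofReal (r ^ s) * ∫⁻ h, F h * ‖fracKernel s h‖ₑ := by
  have hG : Measurable fun h : E => F h * ‖fracKernel s h‖ₑ := by fun_prop
  have h1 : ∫⁻ h, F (r • h) * ‖fracKernel s (r • h)‖ₑ =
      ENNReal.ofReal (r ^ finrank ℝ E)⁻¹ * ∫⁻ h, F h * ‖fracKernel s h‖ₑ := by
    rw [← lintegral_map hG (measurable_const_smul r), Measure.map_addHaar_smul _ hr.ne',
      lintegral_smul_measure, abs_of_pos (by positivity), smul_eq_mul]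
  have h2 : ∀ h : E, F (r • h) * ‖fracKernel s h‖ₑ =
      ENNReal.ofReal (r ^ ((finrank ℝ E : ℝ) + s)) *
        (F (r • h) * ‖fracKernel s (r • h)‖ₑ) := by
    intro h
    have hc : (0 : ℝ) ≤ (r ^ ((finrank ℝ E : ℝ) + s))⁻¹ := by positivity
    rw [fracKernel_smul s hr, enorm_mul, Real.enorm_of_nonneg hc,
      mul_left_comm, ← mul_assoc (ENNReal.ofReal _) (ENNReal.ofReal _),
      ← ENNReal.ofReal_mul (by positivity), mul_inv_cancel₀ (by positivity), ENNReal.ofReal_one,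
      one_mul]
  simp_rw [h2]
  rw [lintegral_const_mul _ (by fun_prop), h1, ← mul_assoc, ← ENNReal.ofReal_mul (by positivity),
    Real.rpow_add hr, Real.rpow_natCast]
  congr 2
  field_simp

lemma integrable_min_mul_fracKernel [Nontrivial E] {s p : ℝ} (hs : 0 < s) (hp : s < p) :
    Integrable fun h : E => min 1 (‖h‖ ^ p) * fracKernel s h := by
  have key := integrable_fun_norm_addHaar (E := E) volume
    (f := fun r : ℝ => min 1 (r ^ p) * (r ^ ((finrank ℝ E : ℝ) + s))⁻¹)
  refine key.2 ?_
  have hd : 1 ≤ finrank ℝ E := finrank_pos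
  have hpow : ∀ y : ℝ, 0 < y → y ^ (finrank ℝ E - 1) * (y ^ ((finrank ℝ E : ℝ) + s))⁻¹ =
      y ^ (-1 - s) := by
    intro y hy
    rw [← Real.rpow_neg hy.le, ← Real.rpow_natCast, ← Real.rpow_add hy]
    congr 1
    push_cast [hd]
    ring
  rw [← Ioc_union_Ioi_eq_Ioi zero_le_one]
  refine IntegrableOn.union ?_ ?_
  · have h1 : IntegrableOn (fun y : ℝ => y ^ (p - 1 - s)) (Ioc 0 1) :=
      (intervalIntegrable_iff_integrableOn_Ioc_of_le zero_le_one).1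
        (intervalIntegral.intervalIntegrable_rpow' (by linarith))
    refine h1.congr_fun (fun y hy => ?_) measurableSet_Ioc
    have := Real.rpow_le_one hy.1.le hy.2 (by linarith : 0 ≤ p)
    simp only [smul_eq_mul]
    rw [min_eq_right this, mul_left_comm, hpow y hy.1, ← Real.rpow_add hy.1]
    congr 1; ring
  · have h1 : IntegrableOn (fun y : ℝ => y ^ (-1 - s)) (Ioi 1) :=
      integrableOn_Ioi_rpow_of_lt (by linarith) one_pos
    refine h1.congr_fun (fun y hy => ?_) measurableSet_Ioi
    have hy1 : (1 : ℝ) < y := hy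
    have := Real.one_le_rpow hy1.le (by linarith : 0 ≤ p)
    simp only [smul_eq_mul]
    rw [min_eq_left this, one_mul, hpow y (by linarith)]

lemma lintegral_min_mul_fracKernel_lt_top [Nontrivial E] {s p : ℝ} (hs : 0 < s) (hp : s < p) :
    ∫⁻ h : E, ENNReal.ofReal (min 1 (‖h‖ ^ p)) * ‖fracKernel s h‖ₑ < ∞ := by
  have := (integrable_min_mul_fracKernel (E := E) hs hp).lintegral_lt_top
  refine lt_of_eq_of_lt (lintegral_congr fun h => ?_) this
  rw [ENNReal.ofReal_mul (by positivity), enorm_fracKernel]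

lemma lintegral_indicator_mul_fracKernel_lt_top [Nontrivial E] {s : ℝ} (hs : 0 < s) :
    ∫⁻ h : E, {h : E | 1 ≤ ‖h‖}.indicator 1 h * ‖fracKernel s h‖ₑ < ∞ := by
  refine (lintegral_mono fun h => ?_).trans_lt
    (lintegral_min_mul_fracKernel_lt_top (E := E) hs (lt_add_one s))
  gcongr
  by_cases hh : 1 ≤ ‖h‖
  · have := Real.one_le_rpow hh (by linarith : 0 ≤ s + 1)
    simp [hh, this]
  · simp [hh]

lemma setLIntegral_fracKernel_le {s : ℝ} {O : Set E} (hO : MeasurableSet O) {x : E}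
    (hx : 0 < Metric.infDist x Oᶜ) :
    ∫⁻ y in Oᶜ, ‖fracKernel s (x - y)‖ₑ ≤ ENNReal.ofReal (Metric.infDist x Oᶜ ^ (-s)) *
      ∫⁻ h : E, {h : E | 1 ≤ ‖h‖}.indicator 1 h * ‖fracKernel s h‖ₑ := by
  set δ := Metric.infDist x Oᶜ with hδ
  have hm : MeasurableSet {h : E | 1 ≤ ‖h‖} := measurableSet_le measurable_const measurable_norm
  have hI : Measurable ({h : E | 1 ≤ ‖h‖}.indicator (1 : E → ℝ≥0∞)) :=
    measurable_one.indicator hm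
  calc ∫⁻ y in Oᶜ, ‖fracKernel s (x - y)‖ₑ
      = ∫⁻ y, Oᶜ.indicator (fun y => ‖fracKernel s (x - y)‖ₑ) y :=
        (lintegral_indicator hO.compl _).symm
    _ ≤ ∫⁻ y, {h : E | 1 ≤ ‖h‖}.indicator 1 (δ⁻¹ • (x - y)) * ‖fracKernel s (x - y)‖ₑ := by
        refine lintegral_mono fun y => ?_
        by_cases hy : y ∈ Oᶜ
        · have h1 : δ ≤ ‖x - y‖ := by
            rw [← dist_eq_norm]; exact Metric.infDist_le_dist_of_mem hy
          have h2 : 1 ≤ ‖δ⁻¹ • (x - y)‖ := by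
            rw [norm_smul, Real.norm_of_nonneg (by positivity), inv_mul_eq_div, le_div_iff₀ hx]
            linarith
          have h3 : δ⁻¹ • (x - y) ∈ {h : E | 1 ≤ ‖h‖} := h2
          rw [indicator_of_mem hy, indicator_of_mem h3]
          simp
        · rw [indicator_of_notMem hy]; exact zero_le
    _ = ∫⁻ h, {h : E | 1 ≤ ‖h‖}.indicator 1 (δ⁻¹ • h) * ‖fracKernel s h‖ₑ :=
        lintegral_sub_left_eq_self
          (fun h : E => {h : E | 1 ≤ ‖h‖}.indicator 1 (δ⁻¹ • h) * ‖fracKernel s h‖ₑ) x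
    _ = _ := by
        rw [lintegral_comp_smul_mul_fracKernel s (inv_pos.2 hx) hI, Real.inv_rpow hx.le,
          Real.rpow_neg hx.le]

/-- Homogeneity and rotation invariance of the symbol attached to the kernel `fracKernel s`. -/
lemma lintegral_comp_inner_mul_fracKernel (s : ℝ) {ψ : ℝ → ℝ≥0∞} (hψ : Measurable ψ)
    {e : E} (he : ‖e‖ = 1) {ξ : E} (hξ : ξ ≠ 0) :
    ∫⁻ h : E, ψ ⟪h, ξ⟫_ℝ * ‖fracKernel s h‖ₑ =
      ENNReal.ofReal (‖ξ‖ ^ s) * ∫⁻ h : E, ψ ⟪h, e⟫_ℝ * ‖fracKernel s h‖ₑ := by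
  have hξ' : 0 < ‖ξ‖ := norm_pos_iff.2 hξ
  have hn : ‖‖ξ‖⁻¹ • ξ‖ = ‖e‖ := by
    rw [norm_smul, norm_inv, norm_norm, inv_mul_cancel₀ hξ'.ne', he]
  set R := (ℝ ∙ (‖ξ‖⁻¹ • ξ - e))ᗮ.reflection with hR
  have hRe : R (‖ξ‖⁻¹ • ξ) = e := Submodule.reflection_sub hn
  have h1 := lintegral_comp_smul_mul_fracKernel (E := E) s hξ'
    (F := fun h => ψ ⟪h, ‖ξ‖⁻¹ • ξ⟫_ℝ) (by fun_prop)
  have h2 : ∀ h : E, ⟪‖ξ‖ • h, ‖ξ‖⁻¹ • ξ⟫_ℝ = ⟪h, ξ⟫_ℝ := by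
    intro h
    rw [real_inner_smul_left, real_inner_smul_right, ← mul_assoc, mul_inv_cancel₀ hξ'.ne', one_mul]
  simp_rw [h2] at h1
  rw [h1]
  congr 1
  have h3 := R.measurePreserving.lintegral_comp
    (f := fun h => ψ ⟪h, e⟫_ℝ * ‖fracKernel s h‖ₑ) (by fun_prop)
  rw [← h3]
  refine lintegral_congr fun h => ?_
  have h4 : ⟪R h, e⟫_ℝ = ⟪h, ‖ξ‖⁻¹ • ξ⟫_ℝ := by
    rw [← hRe, LinearIsometryEquiv.inner_map_map]
  rw [h4]
  simp [fracKernel]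

end Kernel

section Symbol

lemma norm_fourierChar_sub_one_le (t : ℝ) : ‖(𝐞 t : ℂ) - 1‖ ≤ 8 * min 1 |t| := by
  have h1 : ‖(𝐞 t : ℂ) - 1‖ ≤ 2 := by
    refine (norm_sub_le _ _).trans ?_
    rw [Circle.norm_coe, norm_one]; norm_num
  have h2 : ‖(𝐞 t : ℂ) - 1‖ ≤ 2 * Real.pi * |t| := by
    have := Real.norm_exp_I_mul_ofReal_sub_one_le (x := 2 * Real.pi * t)
    rw [Real.norm_eq_abs, abs_mul, abs_of_pos Real.two_pi_pos] at this
    rwa [Real.fourierChar_apply, mul_comm _ Complex.I]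
  have h3 := Real.pi_lt_four
  rcases min_cases 1 |t| with h | h <;> rw [h.1]
  · linarith
  · nlinarith [abs_nonneg t]

variable {E : Type*} [NormedAddCommGroup E] [InnerProductSpace ℝ E] [FiniteDimensional ℝ E]
  [MeasurableSpace E] [BorelSpace E]

lemma lintegral_enorm_fourierChar_sub_one_pow_lt_top [Nontrivial E] {s : ℝ} {m : ℕ} (hs : 0 < s)
    (hm : s < m) {e : E} (he : ‖e‖ = 1) :
    ∫⁻ h : E, ‖(𝐞 ⟪h, e⟫_ℝ : ℂ) - 1‖ₑ ^ m * ‖fracKernel s h‖ₑ < ∞ := by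
  have hle : ∀ h : E, ‖(𝐞 ⟪h, e⟫_ℝ : ℂ) - 1‖ₑ ^ m ≤
      8 ^ m * ENNReal.ofReal (min 1 (‖h‖ ^ (m : ℝ))) := by
    intro h
    have h1 : ‖(𝐞 ⟪h, e⟫_ℝ : ℂ) - 1‖ ≤ 8 * min 1 ‖h‖ := by
      refine (norm_fourierChar_sub_one_le _).trans ?_
      gcongr
      simpa [he] using abs_real_inner_le_norm h e
    have h2 : min 1 ‖h‖ ^ m ≤ min 1 (‖h‖ ^ (m : ℝ)) := by
      rw [Real.rpow_natCast]
      refine le_min (pow_le_one₀ (by positivity) (min_le_left _ _)) ?_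
      gcongr
      exact min_le_right _ _
    rw [← ofReal_norm, ← ENNReal.ofReal_pow (norm_nonneg _)]
    calc ENNReal.ofReal (‖(𝐞 ⟪h, e⟫_ℝ : ℂ) - 1‖ ^ m)
        ≤ ENNReal.ofReal (8 ^ m * min 1 (‖h‖ ^ (m : ℝ))) := by
          gcongr
          calc ‖(𝐞 ⟪h, e⟫_ℝ : ℂ) - 1‖ ^ m ≤ (8 * min 1 ‖h‖) ^ m := by gcongr
            _ = 8 ^ m * min 1 ‖h‖ ^ m := mul_pow _ _ _
            _ ≤ _ := by gcongr
      _ = _ := by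
          rw [ENNReal.ofReal_mul (by positivity), ENNReal.ofReal_pow (by norm_num)]
          norm_num
  calc ∫⁻ h : E, ‖(𝐞 ⟪h, e⟫_ℝ : ℂ) - 1‖ₑ ^ m * ‖fracKernel s h‖ₑ
      ≤ ∫⁻ h : E, 8 ^ m * (ENNReal.ofReal (min 1 (‖h‖ ^ (m : ℝ))) * ‖fracKernel s h‖ₑ) := by
        refine lintegral_mono fun h => ?_
        rw [← mul_assoc]
        gcongr
        exact hle h
    _ = 8 ^ m * ∫⁻ h : E, ENNReal.ofReal (min 1 (‖h‖ ^ (m : ℝ))) * ‖fracKernel s h‖ₑ :=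
        lintegral_const_mul _ (by fun_prop)
    _ < ∞ := ENNReal.mul_lt_top (by simp) (lintegral_min_mul_fracKernel_lt_top hs hm)

lemma lintegral_enorm_fourierChar_sub_one_pow_pos (s : ℝ) (m : ℕ) {e : E} (he : ‖e‖ = 1) :
    0 < ∫⁻ h : E, ‖(𝐞 ⟪h, e⟫_ℝ : ℂ) - 1‖ₑ ^ m * ‖fracKernel s h‖ₑ := by
  have hc : Continuous fun h : E => (𝐞 ⟪h, e⟫_ℝ : ℂ) - 1 := by fun_prop
  have hopen : IsOpen {h : E | (𝐞 ⟪h, e⟫_ℝ : ℂ) - 1 ≠ 0} := isOpen_ne_fun hc continuous_const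
  have hmem : (1 / 2 : ℝ) • e ∈ {h : E | (𝐞 ⟪h, e⟫_ℝ : ℂ) - 1 ≠ 0} := by
    have : (𝐞 (1 / 2 : ℝ) : ℂ) = -1 := by
      rw [Real.fourierChar_apply, ← Complex.exp_pi_mul_I]
      congr 1; push_cast; ring
    simp only [mem_ofPred_eq, real_inner_smul_left, real_inner_self_eq_norm_sq, he, one_pow, mul_one,
      this]
    norm_num
  rw [pos_iff_ne_zero, Ne, lintegral_eq_zero_iff (by fun_prop)]
  intro h0
  refine (hopen.measure_pos volume ⟨_, hmem⟩).ne' (measure_mono_null (fun h hh => ?_) h0)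
  have hh0 : h ≠ 0 := by
    rintro rfl
    simp at hh
  have hk : fracKernel s h ≠ 0 := by
    have := norm_pos_iff.2 hh0
    unfold fracKernel; positivity
  simp only [mem_ofPred_eq] at hh
  simp [hh, hk]

/-- The square of the symbol of order `a` is dominated by the symbol of order `2 * a`. -/
lemma exists_sq_lintegral_symbol_le [Nontrivial E] {a : ℝ} (ha : 0 < a) (ha' : a < 1) :
    ∃ C : ℝ≥0∞, C < ∞ ∧ ∀ ξ : E,
      (∫⁻ h : E, ‖(𝐞 ⟪h, ξ⟫_ℝ : ℂ) - 1‖ₑ * ‖fracKernel a h‖ₑ) ^ 2 ≤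
        C * ∫⁻ h : E, ‖(𝐞 ⟪h, ξ⟫_ℝ : ℂ) - 1‖ₑ ^ 2 * ‖fracKernel (2 * a) h‖ₑ := by
  obtain ⟨e, he⟩ := exists_norm_eq E zero_le_one
  set A := ∫⁻ h : E, ‖(𝐞 ⟪h, e⟫_ℝ : ℂ) - 1‖ₑ * ‖fracKernel a h‖ₑ with hA
  set B := ∫⁻ h : E, ‖(𝐞 ⟪h, e⟫_ℝ : ℂ) - 1‖ₑ ^ 2 * ‖fracKernel (2 * a) h‖ₑ with hB
  have hAt : A < ∞ := by
    simpa using lintegral_enorm_fourierChar_sub_one_pow_lt_top (m := 1) ha (by simpa) he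
  have hBt : B < ∞ :=
    lintegral_enorm_fourierChar_sub_one_pow_lt_top (by linarith) (by push_cast; linarith) he
  have hB0 : 0 < B := lintegral_enorm_fourierChar_sub_one_pow_pos _ _ he
  refine ⟨A ^ 2 / B, ENNReal.div_lt_top (ENNReal.pow_ne_top hAt.ne) hB0.ne', fun ξ => ?_⟩
  rcases eq_or_ne ξ 0 with rfl | hξ
  · simp
  rw [lintegral_comp_inner_mul_fracKernel a (ψ := fun t => ‖(𝐞 t : ℂ) - 1‖ₑ) (by fun_prop) he hξ,
    lintegral_comp_inner_mul_fracKernel (2 * a) (ψ := fun t => ‖(𝐞 t : ℂ) - 1‖ₑ ^ 2)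
      (by fun_prop) he hξ, ← hA, ← hB, mul_pow, mul_left_comm, ENNReal.div_mul_cancel hB0.ne' hBt.ne,
    ← ENNReal.ofReal_pow (by positivity), ← Real.rpow_natCast, ← Real.rpow_mul (norm_nonneg _)]
  rw [Nat.cast_ofNat, mul_comm a 2]

end Symbol

section Plancherel

variable {E : Type*} [NormedAddCommGroup E] [InnerProductSpace ℝ E] [FiniteDimensional ℝ E]
  [MeasurableSpace E] [BorelSpace E]

/-- The increment `x ↦ u (x + h) - u x` of a test function, as a Schwartz function. -/
lemma exists_schwartzMap_increment {u : E → ℝ} (hu : ContDiff ℝ (⊤ : ℕ∞) u)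
    (hc : HasCompactSupport u) (h : E) :
    ∃ W : 𝓢(E, ℂ), (∀ x, W x = ((u (x + h) - u x : ℝ) : ℂ)) ∧
      ∀ ξ, 𝓕 W ξ = ((𝐞 ⟪h, ξ⟫_ℝ : ℂ) - 1) * 𝓕 (fun x => (u x : ℂ)) ξ := by
  have hcd : ContDiff ℝ (⊤ : ℕ∞) fun x => (u x : ℂ) := Complex.ofRealCLM.contDiff.comp hu
  have hcs : HasCompactSupport fun x => (u x : ℂ) := hc.comp_left Complex.ofReal_zero
  have hcd' : ContDiff ℝ (⊤ : ℕ∞) fun x => (u (x + h) : ℂ) :=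
    hcd.comp (contDiff_id.add contDiff_const)
  have hcs' : HasCompactSupport fun x => (u (x + h) : ℂ) :=
    hcs.comp_homeomorph (Homeomorph.addRight h)
  refine ⟨hcs'.toSchwartzMap hcd' - hcs.toSchwartzMap hcd, fun x => by simp, fun ξ => ?_⟩
  rw [← FourierTransform.fourierCLM_apply (R := ℂ), map_sub, FourierTransform.fourierCLM_apply,
    FourierTransform.fourierCLM_apply, sub_mul, one_mul]
  have h1 := congrFun (VectorFourier.fourierIntegral_comp_add_right Real.fourierChar
    (volume : Measure E) (innerₗ E) (fun x => (u x : ℂ)) h) ξ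
  rw [sub_apply]
  congr 1

lemma integral_increment_mul_increment {u : E → ℝ} (hu : ContDiff ℝ (⊤ : ℕ∞) u)
    (hc : HasCompactSupport u) (h k : E) :
    ‖∫ x, (u (x + h) - u x) * (u (x + k) - u x)‖ₑ ≤
      ∫⁻ ξ, ‖𝓕 (fun x => (u x : ℂ)) ξ‖ₑ ^ 2 *
        (‖(𝐞 ⟪h, ξ⟫_ℝ : ℂ) - 1‖ₑ * ‖(𝐞 ⟪k, ξ⟫_ℝ : ℂ) - 1‖ₑ) := by
  obtain ⟨V, hV, hV'⟩ := exists_schwartzMap_increment hu hc h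
  obtain ⟨W, hW, hW'⟩ := exists_schwartzMap_increment hu hc k
  have h1 := SchwartzMap.integral_inner_fourier_fourier V W
  have h2 : ∫ x, ⟪V x, W x⟫_ℂ = ((∫ x, (u (x + h) - u x) * (u (x + k) - u x) : ℝ) : ℂ) := by
    rw [← integral_complex_ofReal]
    refine integral_congr_ae (.of_forall fun x => ?_)
    simp only [hV, hW, RCLike.inner_apply, Complex.conj_ofReal]
    push_cast; ring
  have h3 : ∀ r : ℝ, ‖r‖ₑ = ‖(r : ℂ)‖ₑ := fun r => by
    rw [← ofReal_norm, ← ofReal_norm, Complex.norm_real]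
  rw [h3, ← h2, ← h1]
  refine (enorm_integral_le_lintegral_enorm _).trans (lintegral_mono fun ξ => ?_)
  simp only [RCLike.inner_apply, hV', hW', enorm_mul, RCLike.enorm_conj, map_mul]
  apply le_of_eq; ring

lemma lintegral_increment_sq {u : E → ℝ} (hu : ContDiff ℝ (⊤ : ℕ∞) u)
    (hc : HasCompactSupport u) (h : E) :
    ∫⁻ x, ‖u (x + h) - u x‖ₑ ^ 2 =
      ∫⁻ ξ, ‖𝓕 (fun x => (u x : ℂ)) ξ‖ₑ ^ 2 * ‖(𝐞 ⟪h, ξ⟫_ℝ : ℂ) - 1‖ₑ ^ 2 := by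
  obtain ⟨V, hV, hV'⟩ := exists_schwartzMap_increment hu hc h
  have h1 := SchwartzMap.integral_norm_sq_fourier V
  have h2 : ∀ G : 𝓢(E, ℂ), ∫⁻ x, ‖G x‖ₑ ^ 2 = ENNReal.ofReal (∫ x, ‖G x‖ ^ 2) := by
    intro G
    have hG : Integrable fun x => ‖G x‖ ^ 2 :=
      (memLp_two_iff_integrable_sq_norm G.continuous.aestronglyMeasurable).1 (G.memLp 2)
    rw [ofReal_integral_eq_lintegral_ofReal hG (.of_forall fun x => by positivity)]
    refine lintegral_congr fun x => ?_
    rw [← ofReal_norm, ENNReal.ofReal_pow (norm_nonneg _)]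
  have h3 : ∀ x, ‖u (x + h) - u x‖ₑ = ‖V x‖ₑ := fun x => by
    rw [hV, ← ofReal_norm, ← ofReal_norm, Complex.norm_real]
  simp_rw [h3]
  rw [h2, ← h1, ← h2]
  refine lintegral_congr fun ξ => ?_
  rw [hV', enorm_mul, mul_pow, mul_comm]

end Plancherel

section WholeSpace

variable {E : Type*} [NormedAddCommGroup E] [InnerProductSpace ℝ E] [FiniteDimensional ℝ E]
  [MeasurableSpace E] [BorelSpace E]

omit [FiniteDimensional ℝ E] [MeasurableSpace E] [BorelSpace E] in
lemma exists_abs_sub_le_mul_min {u : E → ℝ} (hu : ContDiff ℝ (⊤ : ℕ∞) u)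
    (hc : HasCompactSupport u) :
    ∃ C : ℝ, 0 ≤ C ∧ ∀ x y, |u x - u y| ≤ C * min 1 ‖x - y‖ := by
  obtain ⟨L, hL⟩ := hu.lipschitzWith_of_hasCompactSupport hc (by simp)
  obtain ⟨B, hB⟩ := hc.exists_bound_of_continuous hu.continuous
  have hB0 : 0 ≤ B := (norm_nonneg _).trans (hB 0)
  refine ⟨max L (2 * B), by positivity, fun x y => ?_⟩
  rw [mul_min_of_nonneg _ _ (by positivity), mul_one]
  refine le_min ?_ ?_
  · have h1 := hB x
    have h2 := hB y
    have h3 := abs_sub (u x) (u y)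
    rw [Real.norm_eq_abs] at h1 h2
    refine le_trans ?_ (le_max_right _ _)
    linarith
  · have := hL.dist_le_mul x y
    rw [Real.dist_eq, dist_eq_norm] at this
    refine this.trans ?_
    gcongr
    exact le_max_left _ _

lemma integrable_increment_mul_fracKernel [Nontrivial E] {a : ℝ} (ha : 0 < a) (ha' : a < 1)
    {u : E → ℝ} (hu : ContDiff ℝ (⊤ : ℕ∞) u) (hc : HasCompactSupport u) (x : E) :
    Integrable fun y => (u x - u y) * fracKernel a (x - y) := by
  obtain ⟨C, hC, hb⟩ := exists_abs_sub_le_mul_min hu hc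
  have hm := hu.continuous.measurable
  have h1 := ((integrable_min_mul_fracKernel (E := E) ha ha').comp_sub_left x).const_mul C
  refine h1.mono' (by fun_prop) (.of_forall fun y => ?_)
  rw [norm_mul, Real.norm_eq_abs, Real.norm_of_nonneg (fracKernel_nonneg _ _), ← mul_assoc,
    Real.rpow_one]
  gcongr
  · exact fracKernel_nonneg _ _
  · exact hb x y

lemma integrable_increment_sq_mul_fracKernel [Nontrivial E] {a : ℝ} (ha : 0 < a) (ha' : a < 1)
    {u : E → ℝ} (hu : ContDiff ℝ (⊤ : ℕ∞) u) (hc : HasCompactSupport u) {O : Set E}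
    (hO : volume O < ∞) :
    Integrable (fun z : E × E => (u z.1 - u z.2) ^ 2 * fracKernel (2 * a) (z.1 - z.2))
      ((volume.restrict O).prod (volume.restrict O)) := by
  obtain ⟨C, hC, hb⟩ := exists_abs_sub_le_mul_min hu hc
  have hm := hu.continuous.measurable
  set J := ∫⁻ h : E, ENNReal.ofReal (min 1 (‖h‖ ^ (2 : ℝ))) * ‖fracKernel (2 * a) h‖ₑ with hJ
  have hJt : J < ∞ := lintegral_min_mul_fracKernel_lt_top (by linarith) (by linarith)
  refine ⟨by fun_prop, ?_⟩
  rw [HasFiniteIntegral, lintegral_prod _ (by fun_prop)]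
  have h1 : ∀ x y, ‖(u x - u y) ^ 2 * fracKernel (2 * a) (x - y)‖ₑ ≤ ENNReal.ofReal (C ^ 2) *
      (ENNReal.ofReal (min 1 (‖x - y‖ ^ (2 : ℝ))) * ‖fracKernel (2 * a) (x - y)‖ₑ) := by
    intro x y
    rw [enorm_mul, ← mul_assoc, ← ENNReal.ofReal_mul (by positivity),
      Real.enorm_of_nonneg (sq_nonneg (u x - u y))]
    gcongr
    rw [← sq_abs]
    calc |u x - u y| ^ 2 ≤ (C * min 1 ‖x - y‖) ^ 2 := by gcongr; exact hb x y
      _ = C ^ 2 * min 1 ‖x - y‖ ^ 2 := mul_pow _ _ _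
      _ ≤ _ := by
        gcongr
        rw [Real.rpow_ofNat]
        refine le_min (pow_le_one₀ (by positivity) (min_le_left _ _)) ?_
        gcongr
        exact min_le_right _ _
  calc ∫⁻ x in O, ∫⁻ y in O, ‖(u x - u y) ^ 2 * fracKernel (2 * a) (x - y)‖ₑ
      ≤ ∫⁻ x in O, ENNReal.ofReal (C ^ 2) * J := by
        refine lintegral_mono fun x => ?_
        refine (setLIntegral_le_lintegral _ _).trans ((lintegral_mono (h1 x)).trans ?_)
        rw [lintegral_const_mul _ (by fun_prop), lintegral_sub_left_eq_self
          (fun h : E => ENNReal.ofReal (min 1 (‖h‖ ^ (2 : ℝ))) * ‖fracKernel (2 * a) h‖ₑ) x]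
    _ < ∞ := by
        rw [setLIntegral_const]
        exact ENNReal.mul_lt_top (ENNReal.mul_lt_top ENNReal.ofReal_lt_top hJt) hO

lemma measurable_fourier_ofReal {u : E → ℝ} (hu : ContDiff ℝ (⊤ : ℕ∞) u)
    (hc : HasCompactSupport u) : Measurable (𝓕 (fun x => (u x : ℂ))) := by
  have hcd : ContDiff ℝ (⊤ : ℕ∞) fun x => (u x : ℂ) := Complex.ofRealCLM.contDiff.comp hu
  have hcs : HasCompactSupport fun x => (u x : ℂ) := hc.comp_left Complex.ofReal_zero
  exact (𝓕 (hcs.toSchwartzMap hcd)).continuous.measurable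

/-- The Gagliardo seminorm over the whole space in terms of the Fourier transform. -/
lemma lintegral_gagliardo_eq_fourier (s : ℝ) {u : E → ℝ} (hu : ContDiff ℝ (⊤ : ℕ∞) u)
    (hc : HasCompactSupport u) :
    ∫⁻ x, ∫⁻ y, ‖u x - u y‖ₑ ^ 2 * ‖fracKernel s (x - y)‖ₑ =
      ∫⁻ ξ, ‖𝓕 (fun x => (u x : ℂ)) ξ‖ₑ ^ 2 *
        ∫⁻ h : E, ‖(𝐞 ⟪h, ξ⟫_ℝ : ℂ) - 1‖ₑ ^ 2 * ‖fracKernel s h‖ₑ := by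
  have hm := hu.continuous.measurable
  have hF := measurable_fourier_ofReal hu hc
  calc ∫⁻ x, ∫⁻ y, ‖u x - u y‖ₑ ^ 2 * ‖fracKernel s (x - y)‖ₑ
      = ∫⁻ x, ∫⁻ h, ‖u (x + h) - u x‖ₑ ^ 2 * ‖fracKernel s h‖ₑ := by
        refine lintegral_congr fun x => ?_
        rw [← lintegral_add_left_eq_self
          (fun y => ‖u x - u y‖ₑ ^ 2 * ‖fracKernel s (x - y)‖ₑ) x]
        refine lintegral_congr fun h => ?_
        rw [sub_add_cancel_left, fracKernel_neg, ← enorm_neg (u x - _), neg_sub]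
    _ = ∫⁻ h, ∫⁻ x, ‖u (x + h) - u x‖ₑ ^ 2 * ‖fracKernel s h‖ₑ :=
        lintegral_lintegral_swap (by fun_prop)
    _ = ∫⁻ h, ∫⁻ ξ, ‖𝓕 (fun x => (u x : ℂ)) ξ‖ₑ ^ 2 *
          (‖(𝐞 ⟪h, ξ⟫_ℝ : ℂ) - 1‖ₑ ^ 2 * ‖fracKernel s h‖ₑ) := by
        refine lintegral_congr fun h => ?_
        rw [lintegral_mul_const _ (by fun_prop), lintegral_increment_sq hu hc,
          ← lintegral_mul_const _ (by fun_prop)]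
        simp_rw [mul_assoc]
    _ = ∫⁻ ξ, ∫⁻ h, ‖𝓕 (fun x => (u x : ℂ)) ξ‖ₑ ^ 2 *
          (‖(𝐞 ⟪h, ξ⟫_ℝ : ℂ) - 1‖ₑ ^ 2 * ‖fracKernel s h‖ₑ) :=
        lintegral_lintegral_swap (by fun_prop)
    _ = _ := by
        refine lintegral_congr fun ξ => ?_
        rw [lintegral_const_mul _ (by fun_prop)]

lemma integrable_increment_prod [Nontrivial E] {a : ℝ} (ha : 0 < a) (ha' : a < 1)
    {u : E → ℝ} (hu : ContDiff ℝ (⊤ : ℕ∞) u) (hc : HasCompactSupport u) :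
    Integrable (fun z : E × (E × E) =>
      ((u (z.1 + z.2.1) - u z.1) * fracKernel a z.2.1) *
        ((u (z.1 + z.2.2) - u z.1) * fracKernel a z.2.2)) := by
  obtain ⟨C, hC, hb⟩ := exists_abs_sub_le_mul_min hu hc
  have hm := hu.continuous.measurable
  have hS : MeasurableSet (tsupport u) := (isClosed_tsupport u).measurableSet
  have hI : Measurable ((tsupport u).indicator (1 : E → ℝ≥0∞)) := measurable_one.indicator hS
  set φ : E → ℝ≥0∞ := fun h => ENNReal.ofReal (min 1 (‖h‖ ^ (1 : ℝ))) * ‖fracKernel a h‖ₑ with hφ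
  have hφm : Measurable φ := by fun_prop
  have hφt : ∫⁻ h, φ h < ∞ := lintegral_min_mul_fracKernel_lt_top ha ha'
  have h1 : ∀ x h, ‖(u (x + h) - u x) * fracKernel a h‖ₑ ≤ ENNReal.ofReal C * φ h := by
    intro x h
    rw [enorm_mul, hφ, ← mul_assoc, ← ENNReal.ofReal_mul hC, Real.enorm_eq_ofReal_abs, Real.rpow_one]
    gcongr
    simpa using hb (x + h) x
  have h2 : ∀ x h, ‖(u (x + h) - u x) * fracKernel a h‖ₑ ≤ ENNReal.ofReal C * φ h *
      ((tsupport u).indicator 1 x + (tsupport u).indicator 1 (x + h)) := by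
    intro x h
    by_cases hx : x ∈ tsupport u
    · refine (h1 x h).trans (le_mul_of_one_le_right' ?_)
      simp [hx]
    by_cases hy : x + h ∈ tsupport u
    · refine (h1 x h).trans (le_mul_of_one_le_right' ?_)
      simp [hy]
    · simp [image_eq_zero_of_notMem_tsupport hx, image_eq_zero_of_notMem_tsupport hy]
  refine ⟨by fun_prop, ?_⟩
  rw [HasFiniteIntegral, Measure.volume_eq_prod, lintegral_prod_symm _ (by fun_prop)]
  calc ∫⁻ p : E × E, ∫⁻ x : E, ‖((u (x + p.1) - u x) * fracKernel a p.1) *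
        ((u (x + p.2) - u x) * fracKernel a p.2)‖ₑ
      ≤ ∫⁻ p : E × E, ∫⁻ x : E, (ENNReal.ofReal C * φ p.1 *
          ((tsupport u).indicator 1 x + (tsupport u).indicator 1 (x + p.1))) *
            (ENNReal.ofReal C * φ p.2) := by
        refine lintegral_mono fun p => lintegral_mono fun x => ?_
        rw [enorm_mul]
        exact mul_le_mul' (h2 x p.1) (h1 x p.2)
    _ = ∫⁻ p : E × E, (ENNReal.ofReal C * φ p.1 * (2 * volume (tsupport u))) *
          (ENNReal.ofReal C * φ p.2) := by
        refine lintegral_congr fun p => ?_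
        rw [lintegral_mul_const _ (by fun_prop), lintegral_const_mul _ (by fun_prop),
          lintegral_add_left hI, lintegral_add_right_eq_self
            (fun x => (tsupport u).indicator (1 : E → ℝ≥0∞) x) p.1,
          lintegral_indicator_one hS, two_mul]
    _ = (∫⁻ h, ENNReal.ofReal C * φ h * (2 * volume (tsupport u))) *
          ∫⁻ h, ENNReal.ofReal C * φ h := by
        rw [Measure.volume_eq_prod]
        exact lintegral_prod_mul (f := fun h => ENNReal.ofReal C * φ h * (2 * volume (tsupport u)))
          (g := fun h => ENNReal.ofReal C * φ h) (by fun_prop) (by fun_prop)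
    _ < ∞ := by
        rw [lintegral_mul_const _ (by fun_prop), lintegral_const_mul _ hφm]
        have hv : volume (tsupport u) < ∞ := hc.isCompact.measure_lt_top
        finiteness

/-- The `L²` norm of the fractional Laplacian is controlled through the symbol of its kernel. -/
lemma lintegral_fracLaplacian_sq_le_fourier [Nontrivial E] {a : ℝ} (ha : 0 < a) (ha' : a < 1)
    {u : E → ℝ} (hu : ContDiff ℝ (⊤ : ℕ∞) u) (hc : HasCompactSupport u) :
    ∫⁻ x, ‖∫ y, (u x - u y) * fracKernel a (x - y)‖ₑ ^ 2 ≤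
      ∫⁻ ξ, ‖𝓕 (fun x => (u x : ℂ)) ξ‖ₑ ^ 2 *
        (∫⁻ h : E, ‖(𝐞 ⟪h, ξ⟫_ℝ : ℂ) - 1‖ₑ * ‖fracKernel a h‖ₑ) ^ 2 := by
  have hm := hu.continuous.measurable
  have hF := measurable_fourier_ofReal hu hc
  have hint := integrable_increment_prod ha ha' hu hc
  rw [Measure.volume_eq_prod] at hint
  have hsq : ∀ x, (∫ y, (u x - u y) * fracKernel a (x - y)) ^ 2 =
      ∫ p : E × E, ((u (x + p.1) - u x) * fracKernel a p.1) *
        ((u (x + p.2) - u x) * fracKernel a p.2) := by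
    intro x
    have h1 : ∫ y, (u x - u y) * fracKernel a (x - y) =
        - ∫ h, (u (x + h) - u x) * fracKernel a h := by
      rw [← integral_neg, ← integral_add_left_eq_self
        (fun y => (u x - u y) * fracKernel a (x - y)) x]
      refine integral_congr_ae (.of_forall fun h => ?_)
      simp only [sub_add_cancel_left, fracKernel_neg]
      ring
    rw [h1, neg_sq, sq, Measure.volume_eq_prod, ← integral_prod_mul]
  have hL : ∫⁻ x, ‖∫ y, (u x - u y) * fracKernel a (x - y)‖ₑ ^ 2 =
      ENNReal.ofReal (∫ x, ∫ p : E × E, ((u (x + p.1) - u x) * fracKernel a p.1) *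
        ((u (x + p.2) - u x) * fracKernel a p.2)) := by
    rw [ofReal_integral_eq_lintegral_ofReal hint.integral_prod_left
      (.of_forall fun x => by simp only [← hsq]; positivity)]
    refine lintegral_congr fun x => ?_
    rw [← hsq, ← sq_abs, ENNReal.ofReal_pow (abs_nonneg _), Real.enorm_eq_ofReal_abs]
  rw [hL, integral_integral_swap hint]
  refine (Real.ofReal_le_enorm _).trans ((enorm_integral_le_lintegral_enorm _).trans ?_)
  calc ∫⁻ p : E × E, ‖∫ x, ((u (x + p.1) - u x) * fracKernel a p.1) *
        ((u (x + p.2) - u x) * fracKernel a p.2)‖ₑ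
      ≤ ∫⁻ p : E × E, ∫⁻ ξ, ‖𝓕 (fun x => (u x : ℂ)) ξ‖ₑ ^ 2 *
          ((‖(𝐞 ⟪p.1, ξ⟫_ℝ : ℂ) - 1‖ₑ * ‖fracKernel a p.1‖ₑ) *
            (‖(𝐞 ⟪p.2, ξ⟫_ℝ : ℂ) - 1‖ₑ * ‖fracKernel a p.2‖ₑ)) := by
        refine lintegral_mono fun p => ?_
        have h1 : ∫ x, ((u (x + p.1) - u x) * fracKernel a p.1) *
            ((u (x + p.2) - u x) * fracKernel a p.2) =
            (∫ x, (u (x + p.1) - u x) * (u (x + p.2) - u x)) *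
              (fracKernel a p.1 * fracKernel a p.2) := by
          rw [← integral_mul_const]
          refine integral_congr_ae (.of_forall fun x => ?_)
          ring
        rw [h1, enorm_mul, enorm_mul]
        refine (mul_le_mul_left (integral_increment_mul_increment hu hc p.1 p.2) _).trans ?_
        rw [← lintegral_mul_const _ (by fun_prop)]
        refine lintegral_mono fun ξ => le_of_eq ?_
        ring
    _ = ∫⁻ ξ, ∫⁻ p : E × E, ‖𝓕 (fun x => (u x : ℂ)) ξ‖ₑ ^ 2 *
          ((‖(𝐞 ⟪p.1, ξ⟫_ℝ : ℂ) - 1‖ₑ * ‖fracKernel a p.1‖ₑ) *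
            (‖(𝐞 ⟪p.2, ξ⟫_ℝ : ℂ) - 1‖ₑ * ‖fracKernel a p.2‖ₑ)) :=
        lintegral_lintegral_swap (by fun_prop)
    _ = _ := by
        refine lintegral_congr fun ξ => ?_
        rw [lintegral_const_mul _ (by fun_prop), Measure.volume_eq_prod, lintegral_prod_mul
          (f := fun h => ‖(𝐞 ⟪h, ξ⟫_ℝ : ℂ) - 1‖ₑ * ‖fracKernel a h‖ₑ)
          (g := fun h => ‖(𝐞 ⟪h, ξ⟫_ℝ : ℂ) - 1‖ₑ * ‖fracKernel a h‖ₑ)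
          (by fun_prop) (by fun_prop), sq (∫⁻ h : E, _)]

/-- On the whole space, the fractional Laplacian of order `a` is bounded in `L²` by the Gagliardo
seminorm of order `a`. -/
lemma exists_lintegral_fracLaplacian_sq_le [Nontrivial E] {a : ℝ} (ha : 0 < a) (ha' : a < 1) :
    ∃ C : ℝ≥0∞, C < ∞ ∧ ∀ u : E → ℝ, ContDiff ℝ (⊤ : ℕ∞) u → HasCompactSupport u →
      ∫⁻ x, ‖∫ y, (u x - u y) * fracKernel a (x - y)‖ₑ ^ 2 ≤
        C * ∫⁻ x, ∫⁻ y, ‖u x - u y‖ₑ ^ 2 * ‖fracKernel (2 * a) (x - y)‖ₑ := by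
  obtain ⟨C, hC, h⟩ := exists_sq_lintegral_symbol_le (E := E) ha ha'
  refine ⟨C, hC, fun u hu hc => (lintegral_fracLaplacian_sq_le_fourier ha ha' hu hc).trans ?_⟩
  rw [lintegral_gagliardo_eq_fourier _ hu hc, ← lintegral_const_mul' _ _ hC.ne]
  refine lintegral_mono fun ξ => ?_
  rw [mul_left_comm]
  gcongr
  exact h ξ

end WholeSpace

section Domain

variable {E : Type*} [NormedAddCommGroup E] [InnerProductSpace ℝ E] [FiniteDimensional ℝ E]
  [MeasurableSpace E] [BorelSpace E]

/-- The Gagliardo seminorm over the whole space of a function vanishing outside `O`. -/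
lemma lintegral_gagliardo_eq_add {s : ℝ} {O : Set E} (hO : MeasurableSet O) {u : E → ℝ}
    (hu : Measurable u) (h0 : ∀ x ∉ O, u x = 0) :
    ∫⁻ x, ∫⁻ y, ‖u x - u y‖ₑ ^ 2 * ‖fracKernel s (x - y)‖ₑ =
      (∫⁻ x in O, ∫⁻ y in O, ‖u x - u y‖ₑ ^ 2 * ‖fracKernel s (x - y)‖ₑ) +
        2 * ∫⁻ x in O, ‖u x‖ₑ ^ 2 * ∫⁻ y in Oᶜ, ‖fracKernel s (x - y)‖ₑ := by
  have hκ : ∀ x, ∫⁻ y in Oᶜ, ‖u x - u y‖ₑ ^ 2 * ‖fracKernel s (x - y)‖ₑ =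
      ‖u x‖ₑ ^ 2 * ∫⁻ y in Oᶜ, ‖fracKernel s (x - y)‖ₑ := by
    intro x
    rw [← lintegral_const_mul _ (by fun_prop)]
    refine setLIntegral_congr_fun hO.compl fun y hy => ?_
    simp only [h0 y hy, sub_zero]
  have hmix : ∫⁻ x in Oᶜ, ∫⁻ y in O, ‖u x - u y‖ₑ ^ 2 * ‖fracKernel s (x - y)‖ₑ =
      ∫⁻ x in O, ‖u x‖ₑ ^ 2 * ∫⁻ y in Oᶜ, ‖fracKernel s (x - y)‖ₑ := by
    rw [lintegral_lintegral_swap (by fun_prop)]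
    refine lintegral_congr fun y => ?_
    rw [← hκ]
    refine lintegral_congr fun x => ?_
    rw [← enorm_neg (u x - u y), neg_sub, ← fracKernel_neg, neg_sub]
  have hcompl : ∫⁻ x in Oᶜ, ∫⁻ y in Oᶜ, ‖u x - u y‖ₑ ^ 2 * ‖fracKernel s (x - y)‖ₑ = 0 := by
    simp_rw [hκ]
    refine (setLIntegral_congr_fun (g := 0) hO.compl fun x hx => ?_).trans lintegral_zero
    simp [h0 x hx]
  have hmeas : ∀ A : Set E, Measurable fun x =>
      ∫⁻ y in A, ‖u x - u y‖ₑ ^ 2 * ‖fracKernel s (x - y)‖ₑ := fun A =>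
    Measurable.lintegral_prod_right' (ν := volume.restrict A)
      (f := fun z : E × E => ‖u z.1 - u z.2‖ₑ ^ 2 * ‖fracKernel s (z.1 - z.2)‖ₑ) (by fun_prop)
  have hsplit : ∀ x, ∫⁻ y, ‖u x - u y‖ₑ ^ 2 * ‖fracKernel s (x - y)‖ₑ =
      (∫⁻ y in O, ‖u x - u y‖ₑ ^ 2 * ‖fracKernel s (x - y)‖ₑ) +
        ∫⁻ y in Oᶜ, ‖u x - u y‖ₑ ^ 2 * ‖fracKernel s (x - y)‖ₑ :=
    fun x => (lintegral_add_compl _ hO).symm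
  simp_rw [hsplit]
  rw [← lintegral_add_compl _ hO, lintegral_add_left (hmeas O), lintegral_add_left (hmeas O),
    hmix, hcompl, add_zero, lintegral_congr hκ]
  ring

lemma enorm_regional_fracLaplacian_le [Nontrivial E] {a : ℝ} (ha : 0 < a) (ha' : a < 1)
    {O : Set E} (hO : MeasurableSet O) {u : E → ℝ} (hu : ContDiff ℝ (⊤ : ℕ∞) u)
    (hc : HasCompactSupport u) (h0 : ∀ x ∉ O, u x = 0) (x : E) :
    ‖∫ y in O, (u x - u y) * fracKernel a (x - y)‖ₑ ≤
      ‖∫ y, (u x - u y) * fracKernel a (x - y)‖ₑ +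
        ‖u x‖ₑ * ∫⁻ y in Oᶜ, ‖fracKernel a (x - y)‖ₑ := by
  have h1 := integral_add_compl hO (integrable_increment_mul_fracKernel ha ha' hu hc x)
  rw [← eq_sub_iff_add_eq] at h1
  rw [h1]
  refine enorm_sub_le.trans ?_
  gcongr
  refine (enorm_integral_le_lintegral_enorm _).trans ?_
  rw [← lintegral_const_mul _ (by fun_prop)]
  refine (setLIntegral_congr_fun hO.compl fun y hy => ?_).le
  simp only [h0 y hy, sub_zero, enorm_mul]

/-- The regional fractional Laplacian is bounded in `L²` by the regional Gagliardo seminorm and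
the Hardy weight. -/
lemma exists_lintegral_regional_sq_le [Nontrivial E] {a : ℝ} (ha : 0 < a) (ha' : a < 1)
    {O : Set E} (hO : IsOpen O) (hOc : Oᶜ.Nonempty) :
    ∃ C : ℝ≥0∞, C < ∞ ∧ ∀ u : E → ℝ, ContDiff ℝ (⊤ : ℕ∞) u → HasCompactSupport u →
      tsupport u ⊆ O →
      ∫⁻ x in O, ‖∫ y in O, (u x - u y) * fracKernel a (x - y)‖ₑ ^ 2 ≤
        C * ((∫⁻ x in O, ∫⁻ y in O, ‖u x - u y‖ₑ ^ 2 * ‖fracKernel (2 * a) (x - y)‖ₑ) +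
          ∫⁻ x in O, ENNReal.ofReal (u x ^ 2 * Metric.infDist x Oᶜ ^ (-(2 * a)))) := by
  obtain ⟨C, hC, hL⟩ := exists_lintegral_fracLaplacian_sq_le (E := E) ha ha'
  set T : ℝ → ℝ≥0∞ := fun s =>
    ∫⁻ h : E, {h : E | 1 ≤ ‖h‖}.indicator 1 h * ‖fracKernel s h‖ₑ with hT
  have hTt : ∀ s, 0 < s → T s < ∞ := fun s hs => lintegral_indicator_mul_fracKernel_lt_top hs
  have hT1 := hTt a ha
  have hT2 := hTt (2 * a) (by linarith)
  refine ⟨2 * C * (1 + 2 * T (2 * a)) + 2 * T a ^ 2, by finiteness, fun u hu hc hs => ?_⟩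
  have hm := hu.continuous.measurable
  have h0 : ∀ x ∉ O, u x = 0 := fun x hx => image_eq_zero_of_notMem_tsupport fun h => hx (hs h)
  have hd : ∀ x ∈ O, 0 < Metric.infDist x Oᶜ := fun x hx =>
    (hO.isClosed_compl.notMem_iff_infDist_pos hOc).1 (by simpa using hx)
  set G := ∫⁻ x in O, ∫⁻ y in O, ‖u x - u y‖ₑ ^ 2 * ‖fracKernel (2 * a) (x - y)‖ₑ with hG
  set H := ∫⁻ x in O, ENNReal.ofReal (u x ^ 2 * Metric.infDist x Oᶜ ^ (-(2 * a))) with hH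
  have hdm : Measurable fun x => ENNReal.ofReal (u x ^ 2 * Metric.infDist x Oᶜ ^ (-(2 * a))) := by
    fun_prop
  have hu2 : ∀ x, ‖u x‖ₑ ^ 2 = ENNReal.ofReal (u x ^ 2) := fun x => by
    rw [← sq_abs, ENNReal.ofReal_pow (abs_nonneg _), Real.enorm_eq_ofReal_abs]
  have hkill : ∫⁻ x in O, ‖u x‖ₑ ^ 2 * ∫⁻ y in Oᶜ, ‖fracKernel (2 * a) (x - y)‖ₑ ≤
      T (2 * a) * H := by
    rw [hH, ← lintegral_const_mul _ hdm]
    refine setLIntegral_mono (by fun_prop) fun x hx => ?_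
    rw [ENNReal.ofReal_mul (sq_nonneg _), ← hu2, mul_left_comm, mul_comm (T _)]
    gcongr
    exact setLIntegral_fracKernel_le hO.measurableSet (hd x hx)
  have hkill' : ∫⁻ x in O, (‖u x‖ₑ * ∫⁻ y in Oᶜ, ‖fracKernel a (x - y)‖ₑ) ^ 2 ≤
      T a ^ 2 * H := by
    rw [hH, ← lintegral_const_mul _ hdm]
    refine setLIntegral_mono (by fun_prop) fun x hx => ?_
    have h2 : ENNReal.ofReal (Metric.infDist x Oᶜ ^ (-(2 * a))) =
        ENNReal.ofReal (Metric.infDist x Oᶜ ^ (-a)) ^ 2 := by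
      rw [← ENNReal.ofReal_pow (Real.rpow_nonneg Metric.infDist_nonneg _), ← Real.rpow_natCast,
        ← Real.rpow_mul (hd x hx).le]
      congr 2; push_cast; ring
    rw [ENNReal.ofReal_mul (sq_nonneg _), ← hu2, mul_left_comm, h2, mul_pow, mul_comm (T a ^ 2),
      ← mul_pow (ENNReal.ofReal _)]
    gcongr
    exact setLIntegral_fracKernel_le hO.measurableSet (hd x hx)
  have hwhole : ∫⁻ x in O, ‖∫ y, (u x - u y) * fracKernel a (x - y)‖ₑ ^ 2 ≤
      C * (G + 2 * (T (2 * a) * H)) := by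
    refine (setLIntegral_le_lintegral _ _).trans ((hL u hu hc).trans ?_)
    rw [lintegral_gagliardo_eq_add hO.measurableSet hm h0]
    gcongr
  have hsq : ∀ p q : ℝ≥0∞, (p + q) ^ 2 ≤ 2 * p ^ 2 + 2 * q ^ 2 := by
    intro p q
    have := ENNReal.rpow_add_le_mul_rpow_add_rpow p q (p := 2) (by norm_num)
    rw [show (2 : ℝ) - 1 = 1 by norm_num, ENNReal.rpow_one, mul_add] at this
    exact_mod_cast this
  have hκm : ∀ s : ℝ, Measurable fun x : E => ∫⁻ y in Oᶜ, ‖fracKernel s (x - y)‖ₑ := fun s =>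
    Measurable.lintegral_prod_right' (ν := volume.restrict Oᶜ)
      (f := fun z : E × E => ‖fracKernel s (z.1 - z.2)‖ₑ) (by fun_prop)
  have hκa := hκm a
  calc ∫⁻ x in O, ‖∫ y in O, (u x - u y) * fracKernel a (x - y)‖ₑ ^ 2
      ≤ ∫⁻ x in O, (2 * ‖∫ y, (u x - u y) * fracKernel a (x - y)‖ₑ ^ 2 +
          2 * (‖u x‖ₑ * ∫⁻ y in Oᶜ, ‖fracKernel a (x - y)‖ₑ) ^ 2) := by
        refine lintegral_mono fun x => le_trans ?_ (hsq _ _)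
        gcongr
        exact enorm_regional_fracLaplacian_le ha ha' hO.measurableSet hu hc h0 x
    _ = 2 * (∫⁻ x in O, ‖∫ y, (u x - u y) * fracKernel a (x - y)‖ₑ ^ 2) +
          2 * ∫⁻ x in O, (‖u x‖ₑ * ∫⁻ y in Oᶜ, ‖fracKernel a (x - y)‖ₑ) ^ 2 := by
        rw [lintegral_add_right _ (by fun_prop), lintegral_const_mul' _ _ (by simp),
          lintegral_const_mul' _ _ (by simp)]
    _ ≤ 2 * (C * (G + 2 * (T (2 * a) * H))) + 2 * (T a ^ 2 * H) := by gcongr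
    _ ≤ 2 * (C * (G + 2 * (T (2 * a) * H))) + 2 * (T a ^ 2 * H) +
          (4 * C * T (2 * a) * G + 2 * T a ^ 2 * G + 2 * C * H) := le_self_add
    _ = _ := by ring

/-- The Hardy weight of a test function is integrable. -/
lemma integrableOn_sq_mul_infDist_rpow {s : ℝ} {O : Set E} (hO : IsOpen O) (hOc : Oᶜ.Nonempty)
    {u : E → ℝ} (hu : Continuous u) (hc : HasCompactSupport u) (hs : tsupport u ⊆ O) :
    IntegrableOn (fun x => u x ^ 2 * Metric.infDist x Oᶜ ^ s) O := by
  refine Integrable.integrableOn ?_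
  have hK : IntegrableOn (fun x => u x ^ 2 * Metric.infDist x Oᶜ ^ s) (tsupport u) := by
    refine ContinuousOn.integrableOn_compact hc.isCompact ?_
    refine (by fun_prop : Continuous fun x => u x ^ 2).continuousOn.mul
      ((Metric.continuous_infDist_pt _).continuousOn.rpow_const fun x hx => .inl ?_)
    exact ((hO.isClosed_compl.notMem_iff_infDist_pos hOc).1 (by simpa using hs hx)).ne'
  refine (integrableOn_iff_integrable_of_support_subset fun x hx => ?_).1 hK
  refine subset_tsupport u fun h => hx ?_
  simp [h]

end Domain

theorem stmt10 (n : ℕ) (hn : 1 ≤ n) (a : ℝ) (ha : 0 < a) (ha' : a < 1)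
    (O : Set (EuclideanSpace ℝ (Fin n))) (hO : IsOpen O) (hOb : Bornology.IsBounded O)
    (C_H : ℝ) (hCH : 0 < C_H)
    (hHardy : ∀ u : EuclideanSpace ℝ (Fin n) → ℝ,
      ContDiff ℝ (⊤ : ℕ∞) u → HasCompactSupport u → tsupport u ⊆ O →
      ∫ x in O, u x ^ 2 * Metric.infDist x Oᶜ ^ (-(2 * a)) ≤
        C_H * ((∫ x in O, u x ^ 2) +
          ∫ x in O, ∫ y in O, (u x - u y) ^ 2 / ‖x - y‖ ^ ((n : ℝ) + 2 * a))) :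
    ∃ C : ℝ, 0 < C ∧
      ∀ u : EuclideanSpace ℝ (Fin n) → ℝ,
        ContDiff ℝ (⊤ : ℕ∞) u → HasCompactSupport u → tsupport u ⊆ O →
        ∫ x in O, (∫ y in O, (u x - u y) / ‖x - y‖ ^ ((n : ℝ) + a)) ^ 2 ≤
          C * ((∫ x in O, u x ^ 2) +
            ∫ x in O, ∫ y in O, (u x - u y) ^ 2 / ‖x - y‖ ^ ((n : ℝ) + 2 * a)) := by
  have : Nontrivial (EuclideanSpace ℝ (Fin n)) :=
    Module.nontrivial_of_finrank_pos (R := ℝ) (by rw [finrank_euclideanSpace_fin]; omega)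
  have hOc : Oᶜ.Nonempty := by
    rw [nonempty_compl]
    rintro rfl
    exact NormedSpace.unbounded_univ ℝ (EuclideanSpace ℝ (Fin n)) hOb
  have hk : ∀ (s r : ℝ) (h : EuclideanSpace ℝ (Fin n)),
      r / ‖h‖ ^ ((n : ℝ) + s) = r * fracKernel s h := by
    intro s r h
    rw [fracKernel, finrank_euclideanSpace_fin, div_eq_mul_inv]
  simp_rw [hk] at hHardy ⊢
  obtain ⟨C, hC, hmain⟩ := exists_lintegral_regional_sq_le ha ha' hO hOc
  refine ⟨C.toReal * (1 + C_H) + 1, by positivity, fun u hu hc hs => ?_⟩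
  set N := ∫ x in O, u x ^ 2 with hN
  set G := ∫ x in O, ∫ y in O, (u x - u y) ^ 2 * fracKernel (2 * a) (x - y) with hG
  have hN0 : 0 ≤ N := integral_nonneg fun x => sq_nonneg _
  have hG0 : 0 ≤ G := integral_nonneg fun x => integral_nonneg fun y =>
    mul_nonneg (sq_nonneg _) (fracKernel_nonneg _ _)
  have hint := integrable_increment_sq_mul_fracKernel ha ha' hu hc hOb.measure_lt_top
  have hGe : ∫⁻ x in O, ∫⁻ y in O, ‖u x - u y‖ₑ ^ 2 * ‖fracKernel (2 * a) (x - y)‖ₑ =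
      ENNReal.ofReal G := by
    rw [hG, ← integral_prod _ hint, ofReal_integral_eq_lintegral_ofReal hint (.of_forall fun z =>
      mul_nonneg (sq_nonneg _) (fracKernel_nonneg _ _)),
      lintegral_prod _ hint.1.aemeasurable.ennreal_ofReal]
    refine lintegral_congr fun x => lintegral_congr fun y => ?_
    rw [ENNReal.ofReal_mul (sq_nonneg _), enorm_fracKernel, ← sq_abs,
      ENNReal.ofReal_pow (abs_nonneg _), Real.enorm_eq_ofReal_abs]
  have hHe : ∫⁻ x in O, ENNReal.ofReal (u x ^ 2 * Metric.infDist x Oᶜ ^ (-(2 * a))) ≤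
      ENNReal.ofReal (C_H * (N + G)) := by
    rw [← ofReal_integral_eq_lintegral_ofReal
      (integrableOn_sq_mul_infDist_rpow hO hOc hu.continuous hc hs)
      (.of_forall fun x => mul_nonneg (sq_nonneg _) (Real.rpow_nonneg Metric.infDist_nonneg _))]
    exact ENNReal.ofReal_le_ofReal (hHardy u hu hc hs)
  have hle : ENNReal.ofReal (∫ x in O, (∫ y in O, (u x - u y) * fracKernel a (x - y)) ^ 2) ≤
      ENNReal.ofReal (C.toReal * (G + C_H * (N + G))) := by
    refine (Real.ofReal_le_enorm _).trans ((enorm_integral_le_lintegral_enorm _).trans ?_)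
    simp_rw [enorm_pow]
    refine (hmain u hu hc hs).trans ?_
    rw [ENNReal.ofReal_mul ENNReal.toReal_nonneg, ENNReal.ofReal_toReal hC.ne, hGe,
      ENNReal.ofReal_add hG0 (by positivity)]
    gcongr
  refine ((ENNReal.ofReal_le_ofReal_iff (by positivity)).1 hle).trans ?_
  have := mul_nonneg (ENNReal.toReal_nonneg (a := C)) hN0
  nlinarith
end

section
/- Let n ≥ 1, 0 < a < 1, and let O ⊆ ℝ^n be a bounded open set with Lebesgue measure |O| > 0. Assume the fractional Poincaré–Wirtinger inequality holds on O: there exists C_PW > 0 such that for every smooth function u : ℝ^n → ℝ, ‖u − |O|^{−1} ∫_O u‖²_{L²(O)} ≤ C_PW ∫_O ∫_O |u(x) − u(y)|² / |x − y|^{n+2a} dy dx. Let O′ ⊆ O be open with |O′| < |O|. Then there exists C > 0 such that for every u ∈ C_c^∞(O′): ∫_{O′} u² dx ≤ C ∫_O ∫_O |u(x) − u(y)|² / |x − y|^{n+2a} dy dx. -/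
open MeasureTheory

/-- Expansion of the mean square deviation from a constant over a set of finite measure. -/
theorem setIntegral_sub_const_sq {α : Type*} [MeasurableSpace α] {μ : Measure α} {s : Set α}
    (hs : μ s ≠ ⊤) {u : α → ℝ} (hu : IntegrableOn u s μ)
    (hu2 : IntegrableOn (fun x => u x ^ 2) s μ) (c : ℝ) :
    ∫ x in s, (u x - c) ^ 2 ∂μ =
      ∫ x in s, u x ^ 2 ∂μ - 2 * c * ∫ x in s, u x ∂μ + c ^ 2 * (μ s).toReal := by
  have hc : IntegrableOn (fun _ => c ^ 2) s μ := integrableOn_const hs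
  have hlin : IntegrableOn (fun x => 2 * c * u x) s μ := hu.const_mul _
  have hexp : (fun x => (u x - c) ^ 2) = fun x => u x ^ 2 - 2 * c * u x + c ^ 2 := by
    funext x; ring
  have hdiff : IntegrableOn (fun x => u x ^ 2 - 2 * c * u x) s μ := hu2.sub hlin
  rw [hexp, integral_add hdiff hc, integral_sub hu2 hlin, integral_const_mul,
    setIntegral_const, smul_eq_mul, measureReal_def]
  ring

/-- Cauchy–Schwarz against the constant function `1` on a set of finite measure. -/
theorem sq_setIntegral_le {α : Type*} [MeasurableSpace α] {μ : Measure α} {s : Set α}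
    (hs : μ s ≠ ⊤) {u : α → ℝ} (hu : IntegrableOn u s μ)
    (hu2 : IntegrableOn (fun x => u x ^ 2) s μ) :
    (∫ x in s, u x ∂μ) ^ 2 ≤ (μ s).toReal * ∫ x in s, u x ^ 2 ∂μ := by
  rcases eq_or_ne (μ s) 0 with h0 | h0
  · simp [setIntegral_measure_zero _ h0, h0]
  have hm : 0 < (μ s).toReal := ENNReal.toReal_pos h0 hs
  have hnn : 0 ≤ ∫ x in s, (u x - (∫ z in s, u z ∂μ) / (μ s).toReal) ^ 2 ∂μ :=
    integral_nonneg fun _ => sq_nonneg _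
  rw [setIntegral_sub_const_sq hs hu hu2] at hnn
  have h := mul_nonneg hm.le hnn
  field_simp at h
  linarith

/-- Assuming the fractional Poincaré–Wirtinger inequality on a bounded open set `O`, the
Poincaré inequality holds on `C_c^∞(O′)` for any open `O′ ⊆ O` with `|O′| < |O|`, with the
Gagliardo seminorm taken over `O × O`. -/
theorem stmt14 (n : ℕ) (hn : 1 ≤ n) (a : ℝ) (ha : 0 < a) (ha' : a < 1)
    (O : Set (EuclideanSpace ℝ (Fin n))) (hO : IsOpen O) (hOb : Bornology.IsBounded O)
    (hpos : 0 < volume O)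
    (C_PW : ℝ) (hCPW : 0 < C_PW)
    (hPW : ∀ u : EuclideanSpace ℝ (Fin n) → ℝ, ContDiff ℝ (⊤ : ℕ∞) u →
      ∫ x in O, (u x - (volume O).toReal⁻¹ * ∫ z in O, u z) ^ 2 ≤
        C_PW * ∫ x in O, ∫ y in O, (u x - u y) ^ 2 / ‖x - y‖ ^ ((n : ℝ) + 2 * a))
    (O' : Set (EuclideanSpace ℝ (Fin n))) (hO' : IsOpen O') (hsub : O' ⊆ O)
    (hlt : volume O' < volume O) :
    ∃ C : ℝ, 0 < C ∧
      ∀ u : EuclideanSpace ℝ (Fin n) → ℝ,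
        ContDiff ℝ (⊤ : ℕ∞) u → HasCompactSupport u → tsupport u ⊆ O' →
        ∫ x in O', u x ^ 2 ≤
          C * ∫ x in O, ∫ y in O, (u x - u y) ^ 2 / ‖x - y‖ ^ ((n : ℝ) + 2 * a) := by
  have hOfin : volume O ≠ ⊤ := hOb.measure_lt_top.ne
  have hO'fin : volume O' ≠ ⊤ := hlt.ne_top
  have hm : 0 < (volume O).toReal := ENNReal.toReal_pos hpos.ne' hOfin
  have hmm : (volume O').toReal < (volume O).toReal := (ENNReal.toReal_lt_toReal hO'fin hOfin).2 hlt
  have hd : 0 < (volume O).toReal - (volume O').toReal := sub_pos.2 hmm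
  refine ⟨(volume O).toReal * C_PW / ((volume O).toReal - (volume O').toReal),
    div_pos (mul_pos hm hCPW) hd, ?_⟩
  intro u hu hcs hsupp
  have hint : Integrable u := hu.continuous.integrable_of_hasCompactSupport hcs
  have hint2 : Integrable (fun x => u x ^ 2) :=
    (hu.continuous.pow 2).integrable_of_hasCompactSupport (hcs.mono fun x hx h => hx (by simp [h]))
  have hzero : ∀ x ∈ O \ O', u x = 0 := fun x hx =>
    image_eq_zero_of_notMem_tsupport fun h => hx.2 (hsupp h)
  have hI : ∫ x in O, u x = ∫ x in O', u x :=
    setIntegral_eq_of_subset_of_forall_sdiff_eq_zero hO.measurableSet hsub hzero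
  have hA : ∫ x in O, u x ^ 2 = ∫ x in O', u x ^ 2 :=
    setIntegral_eq_of_subset_of_forall_sdiff_eq_zero hO.measurableSet hsub
      fun x hx => by simp [hzero x hx]
  have hCS := sq_setIntegral_le hO'fin hint.integrableOn hint2.integrableOn
  have hP := hPW u hu
  rw [setIntegral_sub_const_sq hOfin hint.integrableOn hint2.integrableOn, hI, hA] at hP
  rw [div_mul_eq_mul_div, le_div_iff₀ hd]
  have h := mul_le_mul_of_nonneg_left hP hm.le
  have hL : ∀ A I m : ℝ, 0 < m →
      m * (A - 2 * (m⁻¹ * I) * I + (m⁻¹ * I) ^ 2 * m) = m * A - I ^ 2 := by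
    intro A I m h0
    field_simp
    ring
  rw [hL _ _ _ hm] at h
  linarith
end

section
/- Let n ≥ 1 and 0 < a < 1 with 2a < n. Then there exists a constant C = C(n, a) > 0 such that for every u ∈ C_c^∞(ℝ^n): ( ∫_{ℝ^n} |u(x)|^{2n/(n−2a)} dx )^{(n−2a)/n} ≤ C ∫_{ℝ^n} ∫_{ℝ^n} |u(x) − u(y)|² / |x − y|^{n+2a} dy dx. -/
open MeasureTheory

/-- The model kernel `min 1 ‖z‖² / ‖z‖^(n+2a)` is integrable on `ℝⁿ` for `0 < a < 1`. -/
lemma integrable_min_one_sq_div_norm_rpow {n : ℕ} (hn : 1 ≤ n) {a : ℝ} (ha : 0 < a)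
    (ha' : a < 1) :
    Integrable fun z : EuclideanSpace ℝ (Fin n) =>
      min 1 (‖z‖ ^ 2) / ‖z‖ ^ ((n : ℝ) + 2 * a) := by
  have : Nontrivial (EuclideanSpace ℝ (Fin n)) := by
    have : Nonempty (Fin n) := ⟨⟨0, hn⟩⟩
    infer_instance
  rw [integrable_fun_norm_addHaar (μ := (volume : Measure (EuclideanSpace ℝ (Fin n))))
    (f := fun t : ℝ => min 1 (t ^ 2) / t ^ ((n : ℝ) + 2 * a))]
  rw [finrank_euclideanSpace_fin, ← Set.Ioc_union_Ioi_eq_Ioi zero_le_one, integrableOn_union]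
  have key : ∀ t : ℝ, 0 < t → t ^ (n - 1) / t ^ ((n : ℝ) + 2 * a) = t ^ (-1 - 2 * a) := by
    intro t ht
    rw [← Real.rpow_natCast, ← Real.rpow_sub ht, Nat.cast_sub hn]
    congr 1
    push_cast
    ring
  constructor
  · have h : IntegrableOn (fun t : ℝ => t ^ (1 - 2 * a)) (Set.Ioc 0 1) :=
      (intervalIntegrable_iff_integrableOn_Ioc_of_le zero_le_one).1
        (intervalIntegral.intervalIntegrable_rpow' (by linarith))
    refine h.congr_fun (fun t ht => ?_) measurableSet_Ioc
    have h1 : t ^ 2 ≤ 1 := pow_le_one₀ ht.1.le ht.2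
    simp only [smul_eq_mul]
    rw [min_eq_right h1, mul_div_left_comm, key t ht.1, ← Real.rpow_natCast,
      ← Real.rpow_add ht.1]
    congr 1
    push_cast
    ring
  · have h : IntegrableOn (fun t : ℝ => t ^ (-1 - 2 * a)) (Set.Ioi 1) :=
      integrableOn_Ioi_rpow_of_lt (by linarith) one_pos
    refine h.congr_fun (fun t ht => ?_) measurableSet_Ioi
    have ht' : 1 < t := ht
    have h1 : 1 ≤ t ^ 2 := one_le_pow₀ ht'.le
    simp only [smul_eq_mul]
    rw [min_eq_left h1, mul_div_left_comm, one_mul, key t (by linarith)]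

/-- The Gagliardo integrand of a `C¹` compactly supported function is integrable. -/
lemma integrable_gagliardo {n : ℕ} (hn : 1 ≤ n) {a : ℝ} (ha : 0 < a) (ha' : a < 1)
    {u : EuclideanSpace ℝ (Fin n) → ℝ} (hu : ContDiff ℝ 1 u) (hc : HasCompactSupport u) :
    Integrable (fun p : EuclideanSpace ℝ (Fin n) × EuclideanSpace ℝ (Fin n) =>
      (u p.1 - u p.2) ^ 2 / ‖p.1 - p.2‖ ^ ((n : ℝ) + 2 * a)) (volume.prod volume) := by
  obtain ⟨L, hL⟩ := hu.lipschitzWith_of_hasCompactSupport hc one_ne_zero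
  obtain ⟨M, hM⟩ := hu.continuous.bounded_above_of_compact_support hc
  set h : EuclideanSpace ℝ (Fin n) → ℝ :=
    fun z => min 1 (‖z‖ ^ 2) / ‖z‖ ^ ((n : ℝ) + 2 * a) with h_def
  have hh : Integrable h := integrable_min_one_sq_div_norm_rpow hn ha ha'
  have hk : Integrable ((tsupport u).indicator fun _ => (1 : ℝ)) :=
    (integrable_indicator_iff (isClosed_tsupport u).measurableSet).2
      (integrableOn_const hc.isCompact.measure_lt_top.ne)
  have h1 := hk.convolution_integrand (ContinuousLinearMap.mul ℝ ℝ) hh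
  have h2 := h1.swap
  have hcont := hu.continuous
  refine (((h1.add h2).const_mul ((L : ℝ) ^ 2 + (2 * M) ^ 2))).mono' ?_ (ae_of_all _ ?_)
  · have : Measurable u := hcont.measurable
    exact Measurable.aestronglyMeasurable (by fun_prop)
  · rintro ⟨x, y⟩
    have hsymm : h (y - x) = h (x - y) := by simp only [h_def, norm_sub_rev]
    have hpos : ∀ z, 0 ≤ h z := fun z => by positivity
    simp only [Pi.add_apply, Function.comp_apply, Prod.swap, ContinuousLinearMap.mul_apply',
      hsymm]
    rw [← add_mul, Real.norm_of_nonneg (by positivity)]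
    have hlip : (u x - u y) ^ 2 ≤ (L : ℝ) ^ 2 * ‖x - y‖ ^ 2 := by
      have := hL.dist_le_mul x y
      rw [Real.dist_eq, dist_eq_norm] at this
      rw [← sq_abs, ← mul_pow]
      gcongr
    have hbd : (u x - u y) ^ 2 ≤ (2 * M) ^ 2 := by
      rw [← sq_abs]
      have hx := hM x
      have hy := hM y
      have := abs_sub (u x) (u y)
      rw [Real.norm_eq_abs] at hx hy
      gcongr
      linarith
    have hmin : (u x - u y) ^ 2 ≤ ((L : ℝ) ^ 2 + (2 * M) ^ 2) * min 1 (‖x - y‖ ^ 2) := by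
      rcases le_total 1 (‖x - y‖ ^ 2) with h' | h'
      · rw [min_eq_left h']
        nlinarith [sq_nonneg (L : ℝ)]
      · rw [min_eq_right h']
        nlinarith [sq_nonneg (2 * M), sq_nonneg ‖x - y‖]
    have hF : (u x - u y) ^ 2 / ‖x - y‖ ^ ((n : ℝ) + 2 * a) ≤
        ((L : ℝ) ^ 2 + (2 * M) ^ 2) * (1 * h (x - y)) := by
      rw [h_def, one_mul, ← mul_div_assoc]
      gcongr
    by_cases hx : x ∈ tsupport u
    · refine hF.trans ?_
      have := Set.indicator_nonneg (s := tsupport u) (f := fun _ => (1 : ℝ))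
        (fun _ _ => zero_le_one) y
      have := hpos (x - y)
      rw [Set.indicator_of_mem hx]
      gcongr
      linarith
    by_cases hy : y ∈ tsupport u
    · refine hF.trans ?_
      have := Set.indicator_nonneg (s := tsupport u) (f := fun _ => (1 : ℝ))
        (fun _ _ => zero_le_one) x
      have := hpos (x - y)
      rw [Set.indicator_of_mem hy]
      gcongr
      linarith
    · simp [hx, hy, image_eq_zero_of_notMem_tsupport]

/-- Pointwise control of `|u x|^p`, `p = 2n/(n-2a)`, by the Gagliardo integral at `x`, with the
total mass `∫ |u|^p` entering to the power `2a/n`. -/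
lemma rpow_abs_le_gagliardo {n : ℕ} (hn : 1 ≤ n) {a : ℝ} (ha : 0 < a) (han : 2 * a < n)
    {p : ℝ} (hp : p = 2 * (n : ℝ) / ((n : ℝ) - 2 * a)) {ω : ℝ}
    (hω : ω = volume.real (Metric.ball (0 : EuclideanSpace ℝ (Fin n)) 1))
    {u : EuclideanSpace ℝ (Fin n) → ℝ} (hu : Integrable fun x => |u x| ^ p)
    (hA : 0 < ∫ x, |u x| ^ p) {x : EuclideanSpace ℝ (Fin n)}
    (hx : Integrable fun y => (u x - u y) ^ 2 / ‖x - y‖ ^ ((n : ℝ) + 2 * a)) :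
    |u x| ^ p ≤ 8 / ω * (2 * 2 ^ p / ω) ^ (2 * a / n) * (∫ x, |u x| ^ p) ^ (2 * a / n) *
      ∫ y, (u x - u y) ^ 2 / ‖x - y‖ ^ ((n : ℝ) + 2 * a) := by
  have hn0 : (0 : ℝ) < n := by exact_mod_cast hn
  have hω0 : 0 < ω := by
    rw [hω, Measure.real, ENNReal.toReal_pos_iff]
    exact ⟨Metric.measure_ball_pos _ _ one_pos, measure_ball_lt_top⟩
  have hp0 : 0 < p := hp ▸ div_pos (by linarith) (by linarith)
  set A := ∫ x, |u x| ^ p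
  set G := ∫ y, (u x - u y) ^ 2 / ‖x - y‖ ^ ((n : ℝ) + 2 * a)
  have hG : 0 ≤ G := integral_nonneg fun y => by positivity
  rcases eq_or_ne (u x) 0 with h0 | h0
  · rw [h0, abs_zero, Real.zero_rpow hp0.ne']
    positivity
  have hv : 0 < |u x| := abs_pos.2 h0
  set v := |u x|
  set R : ℝ := 2 * 2 ^ p / ω * A / v ^ p with hR
  have hR0 : 0 < R := by positivity
  set r : ℝ := R ^ (1 / (n : ℝ)) with hr
  have hr0 : 0 < r := by positivity
  have hrn : r ^ (n : ℝ) = R := by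
    rw [hr, ← Real.rpow_mul hR0.le, one_div, inv_mul_cancel₀ hn0.ne', Real.rpow_one]
  have hra : r ^ (2 * a) = R ^ (2 * a / n) := by
    rw [hr, ← Real.rpow_mul hR0.le]
    congr 1
    ring
  have hint : ω * R ≤ 4 * r ^ ((n : ℝ) + 2 * a) / v ^ 2 * G + 2 ^ p / v ^ p * A := by
    have hball : ω * R = ∫ y, (Metric.ball x r).indicator (fun _ => (1 : ℝ)) y := by
      rw [integral_indicator_const _ measurableSet_ball, smul_eq_mul, mul_one,
        Measure.real, Measure.addHaar_ball_of_pos _ _ hr0, ENNReal.toReal_mul,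
        ENNReal.toReal_ofReal (by positivity), ← Measure.real, finrank_euclideanSpace_fin, ← hω,
        ← Real.rpow_natCast, hrn, mul_comm]
    rw [hball, ← integral_const_mul, ← integral_const_mul,
      ← integral_add (hx.const_mul _) (hu.const_mul _)]
    refine integral_mono_of_nonneg
      (ae_of_all _ (Set.indicator_nonneg fun _ _ => zero_le_one))
      ((hx.const_mul _).add (hu.const_mul _)) (ae_of_all _ fun y => ?_)
    by_cases hy : y ∈ Metric.ball x r
    swap
    · rw [Set.indicator_of_notMem hy]
      positivity
    rw [Set.indicator_of_mem hy]
    rcases le_total (v / 2) |u y| with h | h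
    · have h1 : 1 ≤ 2 ^ p / v ^ p * |u y| ^ p := by
        rw [← Real.div_rpow zero_le_two hv.le, ← Real.mul_rpow (by positivity) (abs_nonneg _)]
        refine Real.one_le_rpow ?_ hp0.le
        rw [div_mul_eq_mul_div, le_div_iff₀ hv]
        linarith
      exact h1.trans (le_add_of_nonneg_left (by positivity))
    · have hd : v / 2 ≤ |u x - u y| := by
        have := abs_sub_abs_le_abs_sub (u x) (u y)
        linarith
      have hsq : v ^ 2 / 4 ≤ (u x - u y) ^ 2 := by
        rw [← sq_abs (u x - u y)]
        nlinarith
      have hxy : 0 < ‖x - y‖ := by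
        rw [norm_pos_iff, sub_ne_zero]
        rintro rfl
        rw [sub_self, abs_zero] at hd
        linarith
      have hyr : ‖x - y‖ ≤ r := by
        rw [← dist_eq_norm, dist_comm]
        exact (Metric.mem_ball.1 hy).le
      have h1 : 1 ≤ 4 * r ^ ((n : ℝ) + 2 * a) / v ^ 2 *
          ((u x - u y) ^ 2 / ‖x - y‖ ^ ((n : ℝ) + 2 * a)) := by
        calc (1 : ℝ) = 4 * r ^ ((n : ℝ) + 2 * a) / v ^ 2 *
              ((v ^ 2 / 4) / r ^ ((n : ℝ) + 2 * a)) := by field_simp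
          _ ≤ _ := by gcongr
      exact h1.trans (le_add_of_nonneg_right (by positivity))
  have hhalf : 2 ^ p / v ^ p * A = ω * R / 2 := by
    rw [hR]
    field_simp
  rw [Real.rpow_add hr0, hrn, hra, hhalf] at hint
  have hv2 : v ^ 2 ≤ 8 / ω * R ^ (2 * a / n) * G := by
    have : ω * R / 2 ≤ 4 * (R * R ^ (2 * a / n)) / v ^ 2 * G := by linarith
    rw [div_mul_eq_mul_div, le_div_iff₀ (by positivity)] at this
    rw [div_mul_eq_mul_div, div_mul_eq_mul_div, le_div_iff₀ hω0]
    refine le_of_mul_le_mul_left ?_ (half_pos hR0)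
    linarith
  have hvp : v ^ p = v ^ 2 * (v ^ p) ^ (2 * a / n) := by
    rw [← Real.rpow_mul hv.le, ← Real.rpow_natCast, ← Real.rpow_add hv]
    congr 1
    have : (n : ℝ) - 2 * a ≠ 0 := by linarith
    rw [hp]
    push_cast
    field_simp
    ring
  calc v ^ p = v ^ 2 * (v ^ p) ^ (2 * a / n) := hvp
    _ ≤ 8 / ω * R ^ (2 * a / n) * G * (v ^ p) ^ (2 * a / n) := by gcongr
    _ = 8 / ω * (2 * 2 ^ p / ω) ^ (2 * a / n) * A ^ (2 * a / n) * G := by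
      rw [hR, Real.div_rpow (by positivity) (by positivity),
        Real.mul_rpow (by positivity) hA.le]
      field_simp

/-- Hardy–Littlewood–Sobolev / fractional Sobolev embedding in Gagliardo seminorm form:
`‖u‖²_{L^{2n/(n−2a)}} ≤ C [u]²_{a,ℝⁿ}` for `u ∈ C_c^∞(ℝⁿ)`, `2a < n`. -/
theorem stmt16 (n : ℕ) (hn : 1 ≤ n) (a : ℝ) (ha : 0 < a) (ha' : a < 1)
    (han : 2 * a < n) :
    ∃ C : ℝ, 0 < C ∧
      ∀ u : EuclideanSpace ℝ (Fin n) → ℝ,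
        ContDiff ℝ (⊤ : ℕ∞) u → HasCompactSupport u →
        (∫ x, |u x| ^ (2 * (n : ℝ) / ((n : ℝ) - 2 * a))) ^ (((n : ℝ) - 2 * a) / (n : ℝ)) ≤
          C * ∫ x, ∫ y, (u x - u y) ^ 2 / ‖x - y‖ ^ ((n : ℝ) + 2 * a) := by
  have hn0 : (0 : ℝ) < n := by exact_mod_cast hn
  have hd : 0 < (n : ℝ) - 2 * a := by linarith
  obtain ⟨p, hp⟩ : ∃ p : ℝ, p = 2 * (n : ℝ) / ((n : ℝ) - 2 * a) := ⟨_, rfl⟩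
  obtain ⟨ω, hω⟩ : ∃ ω : ℝ, ω = volume.real (Metric.ball (0 : EuclideanSpace ℝ (Fin n)) 1) :=
    ⟨_, rfl⟩
  have hω0 : 0 < ω := by
    rw [hω, Measure.real, ENNReal.toReal_pos_iff]
    exact ⟨Metric.measure_ball_pos _ _ one_pos, measure_ball_lt_top⟩
  have hp0 : 0 < p := hp ▸ div_pos (by linarith) hd
  refine ⟨8 / ω * (2 * 2 ^ p / ω) ^ (2 * a / n), by positivity, fun u hu hc => ?_⟩
  rw [← hp]
  have hF := integrable_gagliardo hn ha ha' (hu.of_le (by exact_mod_cast le_top)) hc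
  have hup : Integrable fun x => |u x| ^ p := by
    have hcont : Continuous fun x => |u x| ^ p :=
      hu.continuous.abs.rpow_const fun _ => Or.inr hp0.le
    refine hcont.integrable_of_hasCompactSupport
      (hc.comp_left (g := fun t : ℝ => |t| ^ p) ?_)
    rw [abs_zero, Real.zero_rpow hp0.ne']
  have hS : 0 ≤ ∫ x, ∫ y, (u x - u y) ^ 2 / ‖x - y‖ ^ ((n : ℝ) + 2 * a) :=
    integral_nonneg fun x => integral_nonneg fun y => by positivity
  have hA0 : 0 ≤ ∫ x, |u x| ^ p := integral_nonneg fun x => by positivity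
  rcases hA0.eq_or_lt with hA | hA
  · rw [← hA, Real.zero_rpow (div_pos hd hn0).ne']
    positivity
  have hle : ∫ x, |u x| ^ p ≤ 8 / ω * (2 * 2 ^ p / ω) ^ (2 * a / n) *
      (∫ x, |u x| ^ p) ^ (2 * a / n) *
      ∫ x, ∫ y, (u x - u y) ^ 2 / ‖x - y‖ ^ ((n : ℝ) + 2 * a) := by
    rw [← integral_const_mul]
    refine integral_mono_ae hup (hF.integral_prod_left.const_mul _) ?_
    filter_upwards [hF.prod_right_ae] with x hx
    exact rpow_abs_le_gagliardo hn ha han hp hω hup hA hx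
  have hexp : ((n : ℝ) - 2 * a) / n = 1 - 2 * a / n := by field_simp
  rw [hexp, Real.rpow_sub hA, Real.rpow_one, div_le_iff₀ (by positivity)]
  linarith
end

section
/- Let n ≥ 1, 0 < a < 1/2, and let u be a smooth function on ℝ^n with compact support. Define v(x) = ∫_{ℝ^n} (u(x) − u(y)) / |x − y|^{n+2a} dy (which converges absolutely for every x). Then there exists C > 0 such that |v(x)| ≤ C (1 + |x|)^{−(n+2a)} for all x ∈ ℝ^n. -/
open MeasureTheory

open Set in
/-- The radial kernel `r ↦ r / r ^ s / (1 + r)` is integrable on a space of dimension `d` as soon as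
`d < s < d + 1`. -/
theorem integrable_norm_div_rpow_div_one_add {E : Type*} [NormedAddCommGroup E] [NormedSpace ℝ E]
    [FiniteDimensional ℝ E] [Nontrivial E] [MeasurableSpace E] [BorelSpace E]
    (μ : Measure E) [μ.IsAddHaarMeasure] {s : ℝ}
    (hs : (Module.finrank ℝ E : ℝ) < s) (hs' : s < Module.finrank ℝ E + 1) :
    Integrable (fun z : E => ‖z‖ / ‖z‖ ^ s / (1 + ‖z‖)) μ := by
  set d := Module.finrank ℝ E with hd
  have hd1 : 1 ≤ d := Module.finrank_pos
  rw [integrable_fun_norm_addHaar μ (f := fun r : ℝ => r / r ^ s / (1 + r))]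
  have key : ∀ r : ℝ, 0 < r →
      r ^ (d - 1) • (r / r ^ s / (1 + r)) = r ^ ((d : ℝ) - s) / (1 + r) := by
    intro r hr
    rw [smul_eq_mul, Real.rpow_sub hr, Real.rpow_natCast, ← mul_div_assoc, ← mul_div_assoc,
      pow_sub_one_mul (by omega)]
  have hmeas : Measurable fun r : ℝ => r ^ ((d : ℝ) - s) / (1 + r) := by fun_prop
  rw [← hd, integrableOn_congr_fun (s := Ioi 0) key measurableSet_Ioi,
    ← Ioc_union_Ioi_eq_Ioi zero_le_one, integrableOn_union]
  constructor
  · refine Integrable.mono' (g := fun r => r ^ ((d : ℝ) - s)) ?_ hmeas.aestronglyMeasurable ?_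
    · exact (intervalIntegrable_iff_integrableOn_Ioc_of_le zero_le_one).1
        (intervalIntegral.intervalIntegrable_rpow' (by linarith))
    · refine (ae_restrict_iff' measurableSet_Ioc).2 (.of_forall fun r hr => ?_)
      have := hr.1
      rw [Real.norm_of_nonneg (by positivity)]
      exact div_le_self (by positivity) (by linarith)
  · refine Integrable.mono' (g := fun r => r ^ ((d : ℝ) - s - 1))
      (integrableOn_Ioi_rpow_of_lt (by linarith) one_pos) hmeas.aestronglyMeasurable ?_
    refine (ae_restrict_iff' measurableSet_Ioi).2 (.of_forall fun r hr => ?_)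
    have hr : 0 < r := one_pos.trans hr
    rw [Real.norm_of_nonneg (by positivity), Real.rpow_sub_one hr.ne']
    gcongr
    linarith

/-- A bounded Lipschitz function has increments bounded by a multiple of `r / (1 + r)`, where `r`
is the distance between the points. -/
theorem LipschitzWith.abs_sub_le_mul_norm_div_one_add {E : Type*} [SeminormedAddCommGroup E]
    {u : E → ℝ} {L : NNReal} (hL : LipschitzWith L u) {M : ℝ} (hM : ∀ x, ‖u x‖ ≤ M) (x y : E) :
    |u x - u y| ≤ (L + 2 * M) * (‖x - y‖ / (1 + ‖x - y‖)) := by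
  have hr : 0 ≤ ‖x - y‖ := norm_nonneg _
  have h1 : |u x - u y| ≤ L * ‖x - y‖ := hL.norm_sub_le x y
  have h2 : |u x - u y| ≤ 2 * M := by
    have := _root_.norm_sub_le (u x) (u y)
    rw [Real.norm_eq_abs] at this
    linarith [hM x, hM y]
  rw [← mul_div_assoc, le_div_iff₀ (by positivity)]
  nlinarith [mul_le_mul_of_nonneg_right h2 hr]

/-- For `0 < a < 1/2` and `u ∈ C_c^∞(ℝⁿ)`, the fractional Laplacian integral
`v(x) = ∫ (u(x) − u(y))/|x − y|^{n+2a} dy` converges absolutely for every `x` and decays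
like `(1 + |x|)^{−(n+2a)}`. -/
theorem stmt17 (n : ℕ) (hn : 1 ≤ n) (a : ℝ) (ha : 0 < a) (ha' : a < 1 / 2)
    (u : EuclideanSpace ℝ (Fin n) → ℝ)
    (hu : ContDiff ℝ (⊤ : ℕ∞) u) (hcs : HasCompactSupport u) :
    (∀ x, Integrable (fun y => (u x - u y) / ‖x - y‖ ^ ((n : ℝ) + 2 * a)) volume) ∧
    ∃ C : ℝ, 0 < C ∧
      ∀ x : EuclideanSpace ℝ (Fin n),
        |∫ y, (u x - u y) / ‖x - y‖ ^ ((n : ℝ) + 2 * a)| ≤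
          C * (1 + ‖x‖) ^ (-((n : ℝ) + 2 * a)) := by
  have : Nonempty (Fin n) := ⟨⟨0, hn⟩⟩
  have hc : Continuous u := hu.continuous
  obtain ⟨L, hL⟩ := hu.lipschitzWith_of_hasCompactSupport hcs (by simp)
  obtain ⟨M, hM⟩ := hcs.exists_bound_of_continuous hc
  obtain ⟨R, hR1, hR⟩ : ∃ R : ℝ, 1 ≤ R ∧ ∀ x, R < ‖x‖ → u x = 0 := by
    obtain ⟨R, hR⟩ := hcs.isCompact.isBounded.exists_norm_le
    refine ⟨max R 1, le_max_right _ _, fun x hx => image_eq_zero_of_notMem_tsupport fun h => ?_⟩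
    exact absurd ((hR x h).trans (le_max_left _ _)) hx.not_ge
  set s : ℝ := (n : ℝ) + 2 * a with hs
  have hs0 : 0 < s := by positivity
  set K : EuclideanSpace ℝ (Fin n) → ℝ := fun z => (L + 2 * M) * (‖z‖ / ‖z‖ ^ s / (1 + ‖z‖))
  have hK : Integrable K :=
    (integrable_norm_div_rpow_div_one_add volume (by simp; linarith) (by simp; linarith)).const_mul _
  have hbound : ∀ x y, ‖(u x - u y) / ‖x - y‖ ^ s‖ ≤ K (x - y) := fun x y => by
    have h := hL.abs_sub_le_mul_norm_div_one_add hM x y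
    rw [norm_div, Real.norm_of_nonneg (by positivity : 0 ≤ ‖x - y‖ ^ s), Real.norm_eq_abs]
    refine (div_le_div_of_nonneg_right h (by positivity)).trans_eq ?_
    simp only [K]
    ring
  have hKx : ∀ x, Integrable fun y => K (x - y) := fun x => hK.comp_sub_left x
  have hmeas : ∀ x, Measurable fun y => (u x - u y) / ‖x - y‖ ^ s := fun x => by
    have := hc.measurable
    fun_prop
  refine ⟨fun x => (hKx x).mono' (hmeas x).aestronglyMeasurable (.of_forall (hbound x)), ?_⟩
  have hu_int : Integrable u := hc.integrable_of_hasCompactSupport hcs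
  set A : ℝ := ∫ z, K z
  set B : ℝ := ∫ y, ‖u y‖
  have hA : 0 ≤ A := integral_nonneg fun z => by
    simpa using (norm_nonneg _).trans (hbound z 0)
  have hB : 0 ≤ B := integral_nonneg fun y => norm_nonneg _
  refine ⟨A * (1 + 2 * R) ^ s + 4 ^ s * B + 1, by positivity, fun x => ?_⟩
  rw [Real.rpow_neg (by positivity), ← div_eq_mul_inv]
  have hpos : 0 < (1 + ‖x‖) ^ s := by positivity
  rcases le_or_gt ‖x‖ (2 * R) with hx | hx
  · have h1 : |∫ y, (u x - u y) / ‖x - y‖ ^ s| ≤ A :=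
      (norm_integral_le_of_norm_le (hKx x) (.of_forall (hbound x))).trans_eq
        (integral_sub_left_eq_self K volume x)
    rw [le_div_iff₀ hpos]
    calc _ ≤ A * (1 + 2 * R) ^ s := by gcongr
      _ ≤ _ := by linarith [show 0 ≤ (4 : ℝ) ^ s * B by positivity]
  · have hfar : ∀ y, ‖(u x - u y) / ‖x - y‖ ^ s‖ ≤ 4 ^ s / (1 + ‖x‖) ^ s * ‖u y‖ := fun y => by
      rw [hR x (by linarith), zero_sub, norm_div, norm_neg,
        Real.norm_of_nonneg (by positivity : 0 ≤ ‖x - y‖ ^ s)]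
      rcases le_or_gt ‖y‖ R with hy | hy
      · have h2 : (1 + ‖x‖) / 4 ≤ ‖x - y‖ := by linarith [norm_sub_norm_le x y]
        calc ‖u y‖ / ‖x - y‖ ^ s ≤ ‖u y‖ / ((1 + ‖x‖) / 4) ^ s := by gcongr
          _ = _ := by
            rw [Real.div_rpow (by positivity) (by norm_num)]
            field_simp
      · simp [hR y hy]
    have h1 : |∫ y, (u x - u y) / ‖x - y‖ ^ s| ≤ 4 ^ s / (1 + ‖x‖) ^ s * B :=
      (norm_integral_le_of_norm_le (hu_int.norm.const_mul _) (.of_forall hfar)).trans_eq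
        (integral_const_mul _ _)
    refine h1.trans ?_
    rw [div_mul_eq_mul_div]
    gcongr
    linarith [show 0 ≤ A * (1 + 2 * R) ^ s by positivity]
end
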